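/- arXiv:1812.02026 — 3 statements merged into one kernel-verified Lean document; each statement's English description precedes it below -/
import Mathlib

section
/- Let (X,r) be a left non-degenerate solution of the Yang–Baxter equation, M = M(X,r) its structure monoid, A = A(X,r) its derived structure monoid, and 𝒢 = ⟨λ_x : x ∈ X⟩ ⊆ Sym(X). Then there exists an action θ: M → Aut(A) with θ(x) = λ_x for x ∈ X and a bijective 1-cocycle φ: M → A with φ(x) = x for x ∈ X; consequently M embeds into A ⋊ 𝒢 via x ↦ (φ(x), θ(x)), with image {(a, ϕ(a)) : a ∈ A} for ϕ = θ∘φ^{-1}. -/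
/-- `σ_z(x) = λ_z(ρ_{λ_x⁻¹(z)}(x))`. -/
def sigmaMap {X : Type*} (lam : X → Equiv.Perm X) (rho : X → X → X) (z x : X) : X :=
  lam z (rho ((lam x).symm z) x)

/-- Defining relations of the derived structure monoid `A(X,r) = ⟨X | xz = z·σ_z(x)⟩`. -/
def derivedRel {X : Type*} (lam : X → Equiv.Perm X) (rho : X → X → X) :
    FreeMonoid X → FreeMonoid X → Prop := fun a b =>
  ∃ x z : X, a = FreeMonoid.of x * FreeMonoid.of z ∧
    b = FreeMonoid.of z * FreeMonoid.of (sigmaMap lam rho z x)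

/-- The derived structure monoid `A(X,r)`. -/
abbrev DerivedMonoid {X : Type*} (lam : X → Equiv.Perm X) (rho : X → X → X) :=
  (conGen (derivedRel lam rho)).Quotient

/-- The canonical image of a generator `x ∈ X` in `A(X,r)`. -/
def ofA {X : Type*} (lam : X → Equiv.Perm X) (rho : X → X → X) (x : X) :
    DerivedMonoid lam rho := (conGen (derivedRel lam rho)).mk' (FreeMonoid.of x)

/-- Defining relations of the structure monoid `M(X,r) = ⟨X | xy = λ_x(y)·ρ_y(x)⟩`. -/
def structureRel {X : Type*} (lam : X → Equiv.Perm X) (rho : X → X → X) :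
    FreeMonoid X → FreeMonoid X → Prop := fun a b =>
  ∃ x y : X, a = FreeMonoid.of x * FreeMonoid.of y ∧
    b = FreeMonoid.of (lam x y) * FreeMonoid.of (rho y x)

/-- The structure monoid `M(X,r)`. -/
abbrev StructureMonoid {X : Type*} (lam : X → Equiv.Perm X) (rho : X → X → X) :=
  (conGen (structureRel lam rho)).Quotient

/-- The canonical image of a generator `x ∈ X` in `M(X,r)`. -/
def ofM {X : Type*} (lam : X → Equiv.Perm X) (rho : X → X → X) (x : X) :
    StructureMonoid lam rho := (conGen (structureRel lam rho)).mk' (FreeMonoid.of x)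

namespace YB

variable {X : Type*} (lam : X → Equiv.Perm X) (rho : X → X → X)

theorem quot_induction (c : Con (FreeMonoid X)) {P : c.Quotient → Prop} (h1 : P 1)
    (hm : ∀ q x, P q → P (q * c.mk' (FreeMonoid.of x))) (q : c.Quotient) : P q := by
  have key : ∀ w : FreeMonoid X, ∀ q, P q → P (q * c.mk' w) := by
    intro w
    induction w using FreeMonoid.inductionOn with
    | one => intro q hq; simpa using hq
    | of x => intro q hq; exact hm q x hq
    | mul a b ha hb =>
      intro q hq
      rw [map_mul, ← mul_assoc]
      exact hb _ (ha _ hq)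
  obtain ⟨w, rfl⟩ := Con.mk'_surjective q
  simpa using key w 1 h1

theorem relA (x z : X) : ofA lam rho x * ofA lam rho z =
    ofA lam rho z * ofA lam rho (sigmaMap lam rho z x) := by
  unfold ofA
  rw [← map_mul, ← map_mul]
  exact (Con.eq _).2 (ConGen.Rel.of _ _ ⟨x, z, rfl, rfl⟩)

theorem relM (x y : X) : ofM lam rho x * ofM lam rho y =
    ofM lam rho (lam x y) * ofM lam rho (rho y x) := by
  unfold ofM
  rw [← map_mul, ← map_mul]
  exact (Con.eq _).2 (ConGen.Rel.of _ _ ⟨x, y, rfl, rfl⟩)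

/-- Lift a map on generators to the derived monoid. -/
def liftA {N : Type*} [Monoid N] (f : X → N)
    (h : ∀ x z, f x * f z = f z * f (sigmaMap lam rho z x)) : DerivedMonoid lam rho →* N :=
  (conGen (derivedRel lam rho)).lift (FreeMonoid.lift f) (Con.conGen_le.2 (by
    rintro _ _ ⟨x, z, rfl, rfl⟩
    simpa [Con.ker_rel] using h x z))

theorem liftA_of {N : Type*} [Monoid N] (f : X → N)
    (h : ∀ x z, f x * f z = f z * f (sigmaMap lam rho z x)) (x : X) :
    liftA lam rho f h (ofA lam rho x) = f x := by
  unfold liftA ofA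
  exact FreeMonoid.lift_eval_of f x

/-- Lift a map on generators to the structure monoid. -/
def liftM {N : Type*} [Monoid N] (f : X → N)
    (h : ∀ x y, f x * f y = f (lam x y) * f (rho y x)) : StructureMonoid lam rho →* N :=
  (conGen (structureRel lam rho)).lift (FreeMonoid.lift f) (Con.conGen_le.2 (by
    rintro _ _ ⟨x, z, rfl, rfl⟩
    simpa [Con.ker_rel] using h x z))

theorem liftM_of {N : Type*} [Monoid N] (f : X → N)
    (h : ∀ x y, f x * f y = f (lam x y) * f (rho y x)) (x : X) :
    liftM lam rho f h (ofM lam rho x) = f x := by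
  unfold liftM ofM
  exact FreeMonoid.lift_eval_of f x

theorem homA_ext {N : Type*} [Monoid N] {f g : DerivedMonoid lam rho →* N}
    (h : ∀ x, f (ofA lam rho x) = g (ofA lam rho x)) (a : DerivedMonoid lam rho) : f a = g a := by
  induction a using quot_induction with
  | h1 => simp
  | hm q x ih =>
    rw [map_mul, map_mul, ih]
    exact congrArg _ (h x)

/-- Permutations commuting with the derived operation. -/
def K : Subgroup (Equiv.Perm X) where
  carrier := {p | ∀ z x, p (sigmaMap lam rho z x) = sigmaMap lam rho (p z) (p x)}
  one_mem' := fun _ _ => rfl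
  mul_mem' := by
    intro a b ha hb z x
    simp only [Equiv.Perm.mul_apply]
    rw [hb, ha]
  inv_mem' := by
    intro a ha z x
    rw [Equiv.Perm.inv_eq_iff_eq, ha]
    simp

/-- Endomorphism induced by an equivariant permutation. -/
def endA (p : K lam rho) : DerivedMonoid lam rho →* DerivedMonoid lam rho :=
  liftA lam rho (fun x => ofA lam rho (p.1 x)) (by
    intro x z
    rw [p.2 z x]
    exact relA lam rho _ _)

theorem endA_of (p : K lam rho) (x : X) :
    endA lam rho p (ofA lam rho x) = ofA lam rho (p.1 x) := liftA_of _ _ _ _ _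

theorem endA_mul (p q : K lam rho) (a : DerivedMonoid lam rho) :
    endA lam rho (p * q) a = endA lam rho p (endA lam rho q a) :=
  homA_ext lam rho (f := endA lam rho (p * q)) (g := (endA lam rho p).comp (endA lam rho q))
    (fun x => by simp [endA_of]) a

theorem endA_one (a : DerivedMonoid lam rho) : endA lam rho 1 a = a :=
  homA_ext lam rho (f := endA lam rho 1) (g := MonoidHom.id _) (fun x => by simp [endA_of]) a

/-- The action of equivariant permutations on the derived monoid. -/
def autA : K lam rho →* MulAut (DerivedMonoid lam rho) where
  toFun p :=
    { toFun := endA lam rho p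
      invFun := endA lam rho p⁻¹
      left_inv := fun a => by rw [← endA_mul, inv_mul_cancel, endA_one]
      right_inv := fun a => by rw [← endA_mul, mul_inv_cancel, endA_one]
      map_mul' := map_mul _ }
  map_one' := by
    ext a
    exact endA_one lam rho a
  map_mul' p q := by
    ext a
    exact endA_mul lam rho p q a

theorem autA_of (p : K lam rho) (x : X) :
    autA lam rho p (ofA lam rho x) = ofA lam rho (p.1 x) := endA_of _ _ _ _

theorem lam_mem (hYB1 : ∀ x y z : X, lam x (lam y z) = lam (lam x y) (lam (rho y x) z))
    (hYB2 : ∀ x y z : X,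
      lam (rho (lam y z) x) (rho z y) = rho (lam (rho y x) z) (lam x y)) (u : X) :
    lam u ∈ K lam rho := by
  intro z x
  obtain ⟨y, rfl⟩ := (lam x).surjective z
  unfold sigmaMap
  rw [Equiv.symm_apply_apply, hYB1 u (lam x y), hYB2, hYB1 u x y, Equiv.symm_apply_apply]

end YB

open YB
theorem stmt7 {X : Type*} (lam : X → Equiv.Perm X) (rho : X → X → X)
    (hYB1 : ∀ x y z : X, lam x (lam y z) = lam (lam x y) (lam (rho y x) z))
    (hYB2 : ∀ x y z : X,
      lam (rho (lam y z) x) (rho z y) = rho (lam (rho y x) z) (lam x y))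
    (hYB3 : ∀ x y z : X, rho z (rho y x) = rho (rho z y) (rho (lam y z) x)) :
    ∃ (θ : StructureMonoid lam rho →* MulAut (DerivedMonoid lam rho))
      (φ : StructureMonoid lam rho → DerivedMonoid lam rho),
      Function.Bijective φ ∧ φ 1 = 1 ∧
      (∀ m m' : StructureMonoid lam rho, φ (m * m') = φ m * θ m (φ m')) ∧
      (∀ x : X, φ (ofM lam rho x) = ofA lam rho x) ∧
      (∀ x y : X, θ (ofM lam rho x) (ofA lam rho y) = ofA lam rho (lam x y)) ∧
      -- `m ↦ (φ(m), θ(m))` is injective with image `{(a, ϕ(a)) : a ∈ A}` for `ϕ = θ ∘ φ⁻¹`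
      Function.Injective (fun m : StructureMonoid lam rho => (φ m, θ m)) ∧
      Set.range (fun m : StructureMonoid lam rho => (φ m, θ m)) =
        {p : DerivedMonoid lam rho × MulAut (DerivedMonoid lam rho) |
          p.2 = θ (Function.invFun φ p.1)} := by
  have hK := lam_mem lam rho hYB1 hYB2
  let L : StructureMonoid lam rho →* K lam rho := liftM lam rho (fun x => ⟨lam x, hK x⟩) (by
    intro x y
    ext z
    exact hYB1 x y z)
  have hL : ∀ x, L (ofM lam rho x) = ⟨lam x, hK x⟩ := fun x => liftM_of _ _ _ _ _
  let θ : StructureMonoid lam rho →* MulAut (DerivedMonoid lam rho) := (autA lam rho).comp L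
  have hθ : ∀ m x, θ m (ofA lam rho x) = ofA lam rho ((L m).1 x) := fun m x => autA_of _ _ _ _
  have hθg : ∀ x y, θ (ofM lam rho x) (ofA lam rho y) = ofA lam rho (lam x y) := by
    intro x y
    rw [hθ, hL]
  have hθr : ∀ x y b, θ (ofM lam rho x) (θ (ofM lam rho y) b) =
      θ (ofM lam rho (lam x y)) (θ (ofM lam rho (rho y x)) b) := by
    intro x y b
    rw [← MulAut.mul_apply, ← MulAut.mul_apply, ← map_mul, ← map_mul, relM]
  let F : StructureMonoid lam rho →* Function.End (DerivedMonoid lam rho) :=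
    liftM lam rho (fun x b => ofA lam rho x * θ (ofM lam rho x) b) (by
      intro x y
      funext b
      change ofA lam rho x * θ (ofM lam rho x) (ofA lam rho y * θ (ofM lam rho y) b) =
        ofA lam rho (lam x y) * θ (ofM lam rho (lam x y))
          (ofA lam rho (rho y x) * θ (ofM lam rho (rho y x)) b)
      rw [map_mul, map_mul, hθg, hθg, ← mul_assoc, ← mul_assoc, hθr, relA]
      simp [sigmaMap])
  have hF : ∀ x b, F (ofM lam rho x) b = ofA lam rho x * θ (ofM lam rho x) b :=
    fun x b => congrFun (liftM_of lam rho (N := Function.End (DerivedMonoid lam rho)) _ _ x) b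
  let φ : StructureMonoid lam rho → DerivedMonoid lam rho := fun m => F m 1
  have hφ1 : φ 1 = 1 := by
    change F 1 1 = 1
    rw [map_one]; rfl
  have hFm : ∀ m b, F m b = φ m * θ m b := by
    intro m
    induction m using quot_induction with
    | h1 => intro b; rw [hφ1, map_one, map_one, one_mul]; rfl
    | hm q x ih =>
      intro b
      change F (q * ofM lam rho x) b = F (q * ofM lam rho x) 1 * θ (q * ofM lam rho x) b
      rw [map_mul, map_mul]
      change F q (F (ofM lam rho x) b) = F q (F (ofM lam rho x) 1) * θ q (θ (ofM lam rho x) b)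
      rw [ih, ih, hF, hF, map_mul, map_one, mul_one, mul_assoc]
  have hco : ∀ m m', φ (m * m') = φ m * θ m (φ m') := by
    intro m m'
    change F (m * m') 1 = _
    rw [map_mul, ← hFm]; rfl
  have hφx : ∀ x, φ (ofM lam rho x) = ofA lam rho x := by
    intro x
    change F (ofM lam rho x) 1 = _
    rw [hF, map_one, mul_one]
  have hφs : ∀ m x, φ (m * ofM lam rho x) = φ m * ofA lam rho ((L m).1 x) := by
    intro m x
    rw [hco, hφx, hθ]
  let T : DerivedMonoid lam rho →* (Function.End (StructureMonoid lam rho))ᵐᵒᵖ :=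
    liftA lam rho (fun x => MulOpposite.op (fun m => m * ofM lam rho ((L m).1.symm x))) (by
      intro x z
      apply MulOpposite.unop_injective
      funext m
      change m * ofM lam rho ((L m).1.symm x) *
          ofM lam rho ((L (m * ofM lam rho ((L m).1.symm x))).1.symm z) =
        m * ofM lam rho ((L m).1.symm z) *
          ofM lam rho ((L (m * ofM lam rho ((L m).1.symm z))).1.symm (sigmaMap lam rho z x))
      obtain ⟨a, rfl⟩ := (L m).1.surjective x
      obtain ⟨c, rfl⟩ := (L m).1.surjective z
      obtain ⟨b, rfl⟩ := (lam a).surjective c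
      have e : ∀ u v, (L (m * ofM lam rho u)).1.symm ((L m).1 v) = (lam u).symm v := by
        intro u v
        rw [Equiv.symm_apply_eq, map_mul, hL]
        simp
      rw [← (L m).2, e, Equiv.symm_apply_apply, Equiv.symm_apply_apply, Equiv.symm_apply_apply, e,
        mul_assoc, mul_assoc, relM]
      simp [sigmaMap])
  have hT : ∀ x m, (T (ofA lam rho x)).unop m = m * ofM lam rho ((L m).1.symm x) :=
    fun x m => congrFun (congrArg MulOpposite.unop (liftA_of lam rho
      (N := (Function.End (StructureMonoid lam rho))ᵐᵒᵖ) _ _ x)) m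
  let ψ : DerivedMonoid lam rho → StructureMonoid lam rho := fun a => (T a).unop 1
  have hψ1 : ψ 1 = 1 := by
    change (T 1).unop 1 = 1
    rw [map_one]; rfl
  have hψs : ∀ a x, ψ (a * ofA lam rho x) = ψ a * ofM lam rho ((L (ψ a)).1.symm x) := by
    intro a x
    rw [← hT]
    change (T (a * ofA lam rho x)).unop 1 = _
    rw [map_mul]; rfl
  have hl : ∀ m, ψ (φ m) = m := by
    intro m
    induction m using quot_induction with
    | h1 => rw [hφ1, hψ1]
    | hm q x ih =>
      change ψ (φ (q * ofM lam rho x)) = q * ofM lam rho x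
      rw [hφs, hψs, ih, Equiv.symm_apply_apply]
  have hr : ∀ a, φ (ψ a) = a := by
    intro a
    induction a using quot_induction with
    | h1 => rw [hψ1, hφ1]
    | hm q x ih =>
      change φ (ψ (q * ofA lam rho x)) = q * ofA lam rho x
      rw [hψs, hφs, ih, Equiv.apply_symm_apply]
  have hb : Function.Bijective φ := ⟨Function.LeftInverse.injective hl,
    Function.RightInverse.surjective hr⟩
  refine ⟨θ, φ, hb, hφ1, hco, hφx, hθg, fun m m' h => hb.1 (Prod.ext_iff.1 h).1, ?_⟩
  ext ⟨a, g⟩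
  constructor
  · rintro ⟨m, hm⟩
    obtain ⟨rfl, rfl⟩ := Prod.ext_iff.1 hm
    change θ m = θ (Function.invFun φ (φ m))
    rw [Function.leftInverse_invFun hb.1 m]
  · intro h
    change g = θ (Function.invFun φ a) at h
    refine ⟨Function.invFun φ a, Prod.ext ?_ h.symm⟩
    exact Function.rightInverse_invFun hb.2 a
end

section
/- Let (X,r) be a finite bijective left non-degenerate solution, M = M(X,r) its structure monoid. If xz = yz or zx = zy for some x,y,z ∈ M, then there exists a central element w ∈ Z(M) with xw = yw. Consequently M is left cancellative if and only if it is right cancellative, and η_M = {(x,y) : xz = yz for some z ∈ M} is the cancellative congruence of M. -/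
section Abstract

theorem end_mul_apply {M : Type*} (p q : Function.End M) (m : M) : (p * q) m = p (q m) := rfl

theorem end_one_apply {M : Type*} (m : M) : (1 : Function.End M) m = m := rfl

variable {X M : Type*} [Fintype X] [Monoid M]

/-- The operator `m ↦ m * λ_m⁻¹(x)`. -/
def opT (lm : M →* Equiv.Perm X) (g : X → M) (x : X) : Function.End M :=
  fun m => m * g ((lm m)⁻¹ x)

/-- Left multiplication. -/
def opL (n : M) : Function.End M := fun m => n * m

theorem opL_opT (lm : M →* Equiv.Perm X) (g : X → M) (n : M) (x : X) :
    opL n * opT lm g x = opT lm g (lm n x) * opL n := by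
  funext m
  simp [end_mul_apply, opL, opT, mul_assoc]

theorem opL_list (lm : M →* Equiv.Perm X) (g : X → M) (n : M) (l : List X) :
    opL n * (l.map (opT lm g)).prod = ((l.map (lm n)).map (opT lm g)).prod * opL n := by
  induction l with
  | nil => simp
  | cons x l ih =>
    simp only [List.map_cons, List.prod_cons]
    rw [← mul_assoc, opL_opT, mul_assoc, ih, mul_assoc]

theorem exists_list (lm : M →* Equiv.Perm X) (g : X → M)
    (hgen : Submonoid.closure (Set.range g) = ⊤) (m : M) :
    ∃ l : List X, (l.map (opT lm g)).prod 1 = m := by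
  have hm : m ∈ Submonoid.closure (Set.range g) := by rw [hgen]; trivial
  induction hm using Submonoid.closure_induction_right with
  | one => exact ⟨[], rfl⟩
  | mul_right a ha y hy ih =>
    obtain ⟨l, hl⟩ := ih
    obtain ⟨x, rfl⟩ := hy
    refine ⟨lm a x :: l, ?_⟩
    simp [end_mul_apply, hl, opT]

theorem twist_pow (lm : M →* Equiv.Perm X) (g : X → M) (P : Function.End M) (τ : Equiv.Perm X)
    (h : ∀ x, P * opT lm g x = opT lm g (τ x) * P) (k : ℕ) (x : X) :
    P ^ k * opT lm g x = opT lm g ((τ ^ k) x) * P ^ k := by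
  induction k generalizing x with
  | zero => simp
  | succ k ih => rw [pow_succ, mul_assoc, h, ← mul_assoc, ih, mul_assoc]; simp [pow_succ]

theorem twist_card (lm : M →* Equiv.Perm X) (g : X → M) (P : Function.End M) (τ : Equiv.Perm X)
    (h : ∀ x, P * opT lm g x = opT lm g (τ x) * P) (x : X) :
    Commute (P ^ Nat.card (Equiv.Perm X)) (opT lm g x) := by
  have := twist_pow lm g P τ h (Nat.card (Equiv.Perm X)) x
  rwa [pow_card_eq_one'] at this

theorem abstract_main (lm : M →* Equiv.Perm X) (g : X → M)
    (hgen : Submonoid.closure (Set.range g) = ⊤) (σ : X → Equiv.Perm X)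
    (hrel : ∀ x y, g x * g ((lm (g x))⁻¹ y) = g y * g ((lm (g y))⁻¹ (σ y x)))
    (hσ : ∀ m x y, lm m (σ y x) = σ (lm m y) (lm m x))
    (x y z : M) (h : x * z = y * z ∨ z * x = z * y) :
    ∃ w : M, (∀ u, u * w = w * u) ∧ x * w = y * w := by
  classical
  set E := Nat.card (Equiv.Perm X) with hE
  have hE0 : 0 < E := Nat.card_pos
  set T := opT lm g with hT
  -- the basic commutation
  have hTT : ∀ a b, T a * T b = T (σ a b) * T a := by
    intro a b
    funext m
    have h1 := hrel ((lm m)⁻¹ b) ((lm m)⁻¹ a)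
    have h2 : (lm m)⁻¹ (σ a b) = σ ((lm m)⁻¹ a) ((lm m)⁻¹ b) := by
      rw [Equiv.Perm.inv_eq_iff_eq, hσ]; simp
    simp only [end_mul_apply, hT, opT, map_mul, mul_inv_rev,
      Equiv.Perm.mul_apply, h2, mul_assoc, h1]
  have hlist : ∀ l : List X, ∃ τ : Equiv.Perm X, ∀ b,
      (l.map T).prod * T b = T (τ b) * (l.map T).prod := by
    intro l
    induction l with
    | nil => exact ⟨1, by simp⟩
    | cons a l ih =>
      obtain ⟨τ, ih⟩ := ih
      refine ⟨σ a * τ, fun b => ?_⟩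
      simp only [List.map_cons, List.prod_cons, mul_assoc, ih, Equiv.Perm.mul_apply]
      rw [← mul_assoc, hTT, mul_assoc]
  have hcomm : ∀ a b, Commute (T a ^ E) (T b) := fun a b =>
    twist_card lm g (T a) (σ a) (hTT a) b
  let c0 : X → Function.End M := fun a => T a ^ E
  have hcc : ∀ p ∈ Set.range c0, ∀ q ∈ Set.range c0, p * q = q * p := by
    rintro _ ⟨a, rfl⟩ _ ⟨b, rfl⟩
    exact ((hcomm a b).pow_right E).eq
  letI : CommMonoid (Submonoid.closure (Set.range c0)) :=
    { (inferInstance : Monoid (Submonoid.closure (Set.range c0))) with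
      mul_comm := (Submonoid.isMulCommutative_closure _ hcc).is_comm.comm }
  let c : X → Submonoid.closure (Set.range c0) :=
    fun a => ⟨c0 a, Submonoid.subset_closure ⟨a, rfl⟩⟩
  let W : Function.End M := ((∏ a, c a : Submonoid.closure (Set.range c0)) : Function.End M)
  have hWT : ∀ b, Commute W (T b) := by
    intro b
    have : ∀ s : Finset X,
        Commute ((∏ a ∈ s, c a : Submonoid.closure (Set.range c0)) : Function.End M) (T b) := by
      intro s
      induction s using Finset.induction_on with
      | empty => exact Commute.one_left _
      | insert a s ha ih =>
        rw [Finset.prod_insert ha]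
        exact (hcomm a b).mul_left ih
    exact this _
  have hWL : ∀ n : M, opL n * W = W * opL n := by
    intro n
    have h1 : ∀ a, opL n * T a = T (lm n a) * opL n := opL_opT lm g n
    have h2 : ∀ a k, opL n * T a ^ k = T (lm n a) ^ k * opL n := by
      intro a k
      exact (show SemiconjBy (opL n) (T a) (T (lm n a)) from h1 a).pow_right k
    have : ∀ s : Finset X,
        opL n * ((∏ a ∈ s, c a : Submonoid.closure (Set.range c0)) : Function.End M)
        = ((∏ a ∈ s, c (lm n a) : Submonoid.closure (Set.range c0)) : Function.End M) * opL n := by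
      intro s
      induction s using Finset.induction_on with
      | empty => exact (mul_one _).trans (one_mul _).symm
      | insert a s ha ih =>
        rw [Finset.prod_insert ha, Finset.prod_insert ha]
        change opL n * (T a ^ E * _) = (T (lm n a) ^ E * _) * opL n
        rw [← mul_assoc, h2, mul_assoc, ih, mul_assoc]
    have h3 := this Finset.univ
    rwa [Equiv.prod_comp (lm n) c] at h3
  have hWB : ∀ a, ∃ B, W = B * T a := by
    intro a
    refine ⟨((∏ b ∈ Finset.univ.erase a, c b : Submonoid.closure (Set.range c0)) :
      Function.End M) * T a ^ (E - 1), ?_⟩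
    have h1 := Finset.prod_erase_mul Finset.univ c (Finset.mem_univ a)
    have h2 := congrArg (Subtype.val) h1
    rw [mul_assoc, ← pow_succ, Nat.sub_add_cancel hE0]
    exact h2.symm
  have hWlist : ∀ l : List X, Commute W (l.map T).prod := by
    intro l
    apply Commute.list_prod_right
    intro p hp
    obtain ⟨a, -, rfl⟩ := List.mem_map.1 hp
    exact hWT a
  set w := W 1 with hw
  have hWm : ∀ n, W n = n * w := by
    intro n
    have := congrFun (hWL n) 1
    simp only [end_mul_apply, opL, mul_one] at this
    exact this.symm
  -- reduction to equality after a word of operators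
  have key : ∀ (l : List X) (p q : M), (l.map T).prod p = (l.map T).prod q →
      ∃ N : ℕ, p * w ^ N = q * w ^ N := by
    intro l
    induction l with
    | nil => intro p q hpq; exact ⟨0, by simpa [end_one_apply] using hpq⟩
    | cons a l ih =>
      intro p q hpq
      obtain ⟨B, hB⟩ := hWB a
      have h1 : ∀ r, (l.map T).prod (W r) = B (((a :: l).map T).prod r) := by
        intro r
        have e1 := congrFun (hWlist l).eq r
        have e2 := congrFun hB ((l.map T).prod r)
        exact e1.symm.trans e2
      obtain ⟨N, hN⟩ := ih (W p) (W q) (by rw [h1, h1, hpq])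
      refine ⟨N + 1, ?_⟩
      rw [hWm, hWm] at hN
      simpa [pow_succ', mul_assoc] using hN
  have fin : ∀ N : ℕ, x * w ^ N = y * w ^ N →
      ∃ w : M, (∀ u, u * w = w * u) ∧ x * w = y * w := by
    intro N hN
    refine ⟨(w ^ N) ^ E, fun u => ?_, ?_⟩
    · have hl1 : lm ((w ^ N) ^ E) = 1 := by rw [map_pow, hE, pow_card_eq_one']
      obtain ⟨l, hl⟩ := exists_list lm g hgen u
      have hpow : ∀ k : ℕ, ∀ n, (W ^ k) n = n * w ^ k := by
        intro k
        induction k with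
        | zero => intro n; simp [end_one_apply]
        | succ k ih =>
          intro n
          rw [pow_succ]
          change (W ^ k) (W n) = _
          rw [ih, hWm, pow_succ', mul_assoc]
      have e1 := congrFun (opL_list lm g ((w ^ N) ^ E) l) 1
      have e2 := congrFun ((hWlist l).pow_left (N * E)).eq 1
      simp only [end_mul_apply, hl1, opL, mul_one] at e1 e2
      rw [hpow, hpow] at e2
      simp only [Equiv.Perm.coe_one, List.map_id, one_mul, ← hT] at e1 e2
      rw [hl] at e1 e2
      rw [e1, ← pow_mul, e2]
    · obtain ⟨k, hk⟩ := Nat.exists_eq_succ_of_ne_zero hE0.ne'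
      rw [hk, pow_succ', ← mul_assoc, hN, mul_assoc]
  have main : ∀ l : List X, (l.map T).prod x = (l.map T).prod y →
      ∃ w : M, (∀ u, u * w = w * u) ∧ x * w = y * w := by
    intro l hl
    obtain ⟨N, hN⟩ := key l x y hl
    exact fin N hN
  have mulT : ∀ (n : M) (l : List X),
      n * (l.map T).prod 1 = ((l.map (lm n)).map T).prod n := by
    intro n l
    have e1 := congrFun (opL_list lm g n l) 1
    simp only [end_mul_apply, opL, mul_one] at e1
    exact e1
  rcases h with h | h
  · have hxy : lm x = lm y := by
      have := congrArg lm h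
      rwa [map_mul, map_mul, mul_left_inj] at this
    obtain ⟨l, hl⟩ := exists_list lm g hgen z
    rw [← hl] at h
    change x * (l.map T).prod 1 = y * (l.map T).prod 1 at h
    rw [mulT, mulT, hxy] at h
    exact main _ h
  · -- replace `z` by a power with trivial `λ`
    set v := z ^ E with hv
    have hlv : lm v = 1 := by rw [hv, map_pow, hE, pow_card_eq_one']
    have hvv : v * x = v * y := by
      obtain ⟨k, hk⟩ := Nat.exists_eq_succ_of_ne_zero hE0.ne'
      rw [hv, hk, pow_succ, mul_assoc, h, mul_assoc]
    obtain ⟨l, hl⟩ := exists_list lm g hgen v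
    change (l.map T).prod 1 = v at hl
    set V := (l.map T).prod with hV
    obtain ⟨τ, hτ⟩ := hlist l
    have hVc : ∀ b, Commute (V ^ E) (T b) := twist_card lm g V τ hτ
    have hVl : ∀ u : List X, Commute (V ^ E) (u.map T).prod := by
      intro u
      apply Commute.list_prod_right
      intro p hp
      obtain ⟨a, -, rfl⟩ := List.mem_map.1 hp
      exact hVc a
    have hvp : ∀ k : ℕ, v ^ k = (V ^ k) 1 := by
      intro k
      induction k with
      | zero => simp [end_one_apply]
      | succ k ih =>
        have := mulT (v ^ k) l
        rw [map_pow, hlv, one_pow] at this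
        simp only [Equiv.Perm.coe_one, List.map_id] at this
        rw [← hV, hl] at this
        rw [pow_succ, this, ih, pow_succ']
        rfl
    have hvE : ∀ n, v ^ E * n = (V ^ E) n := by
      intro n
      obtain ⟨u, hu⟩ := exists_list lm g hgen n
      change (u.map T).prod 1 = n at hu
      have h1 := mulT (v ^ E) u
      rw [map_pow, hlv, one_pow] at h1
      simp only [Equiv.Perm.coe_one, List.map_id] at h1
      rw [hu, hvp] at h1
      have h2 := congrFun (hVl u).eq 1
      simp only [end_mul_apply] at h2
      rw [hvp, h1, ← h2, hu]
    have hfin : (V ^ E) x = (V ^ E) y := by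
      rw [← hvE, ← hvE]
      obtain ⟨k, hk⟩ := Nat.exists_eq_succ_of_ne_zero hE0.ne'
      rw [hk, pow_succ, mul_assoc, hvv, mul_assoc]
    have hrep : ∀ k : ℕ, V ^ k = (((List.replicate k l).flatten).map T).prod := by
      intro k
      induction k with
      | zero => simp
      | succ k ih => rw [pow_succ', ih, List.replicate_succ, List.flatten_cons, List.map_append,
          List.prod_append]
    rw [hrep] at hfin
    exact main _ hfin

end Abstract

theorem stmt15_main {X : Type*} [Fintype X] (lam : X → Equiv.Perm X) (rho : X → X → X)
    (hYB1 : ∀ x y z : X, lam x (lam y z) = lam (lam x y) (lam (rho y x) z))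
    (hYB2 : ∀ x y z : X,
      lam (rho (lam y z) x) (rho z y) = rho (lam (rho y x) z) (lam x y))
    (hbij : Function.Bijective (fun p : X × X => (lam p.1 p.2, rho p.2 p.1))) :
    ∀ x y z : StructureMonoid lam rho, (x * z = y * z ∨ z * x = z * y) →
      ∃ w : StructureMonoid lam rho, (∀ u, u * w = w * u) ∧ x * w = y * w := by
  let lm : StructureMonoid lam rho →* Equiv.Perm X :=
    Con.lift _ (FreeMonoid.lift lam) (by
      rw [Con.conGen_le]
      rintro _ _ ⟨x, y, rfl, rfl⟩
      simp only [Con.ker_rel, map_mul, FreeMonoid.lift_eval_of]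
      ext z
      exact hYB1 x y z)
  let g : X → StructureMonoid lam rho := ofM lam rho
  have hlg : ∀ x, lm (g x) = lam x := fun x => rfl
  have hgen : Submonoid.closure (Set.range g) = ⊤ := by
    rw [eq_top_iff]
    rintro m -
    induction m using Con.induction_on with
    | _ a =>
      induction a using FreeMonoid.inductionOn' with
      | one => exact one_mem _
      | of_mul x a ih => 
        have hx : g x ∈ Submonoid.closure (Set.range g) := Submonoid.subset_closure ⟨x, rfl⟩
        exact mul_mem hx ih
  have hgg : ∀ x y, g x * g y = g (lam x y) * g (rho y x) := by
    intro x y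
    exact (Con.eq _).2 (ConGen.Rel.of _ _ ⟨x, y, rfl, rfl⟩)
  let s : X → X → X := fun y x => lam y (rho ((lam x)⁻¹ y) x)
  have hs : ∀ y, Function.Injective (s y) := by
    intro y a b hab
    have h1 := (lam y).injective hab
    have h2 := @hbij.1 (a, (lam a)⁻¹ y) (b, (lam b)⁻¹ y) (by simpa using h1)
    exact congrArg Prod.fst h2
  let σ : X → Equiv.Perm X := fun y =>
    Equiv.ofBijective (s y) (Finite.injective_iff_bijective.1 (hs y))
  have hσs : ∀ y x, σ y x = lam y (rho ((lam x)⁻¹ y) x) := fun y x => rfl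
  have hequi : ∀ u x y, lam u (σ y x) = σ (lam u y) (lam u x) := by
    intro u x y
    obtain ⟨z, rfl⟩ := (lam x).surjective y
    have h1 : (lam (lam u x))⁻¹ (lam u (lam x z)) = lam (rho x u) z := by
      rw [Equiv.Perm.inv_eq_iff_eq, hYB1]
    rw [hσs, hσs, h1, ← hYB2, ← hYB1]
    simp
  refine abstract_main lm g hgen σ ?_ ?_
  · intro x y
    rw [hlg, hlg, hgg, hσs]
    simp
  · intro m
    have hm : m ∈ Submonoid.closure (Set.range g) := by rw [hgen]; trivial
    induction hm using Submonoid.closure_induction with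
    | mem a ha => obtain ⟨u, rfl⟩ := ha; intro x y; exact hequi u x y
    | one => simp
    | mul a b _ _ iha ihb => intro x y; simp [ihb, iha]

theorem stmt15 {X : Type*} [Fintype X] (lam : X → Equiv.Perm X) (rho : X → X → X)
    (hYB1 : ∀ x y z : X, lam x (lam y z) = lam (lam x y) (lam (rho y x) z))
    (hYB2 : ∀ x y z : X,
      lam (rho (lam y z) x) (rho z y) = rho (lam (rho y x) z) (lam x y))
    (hYB3 : ∀ x y z : X, rho z (rho y x) = rho (rho z y) (rho (lam y z) x))
    (hbij : Function.Bijective (fun p : X × X => (lam p.1 p.2, rho p.2 p.1))) :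
    -- if `xz = yz` or `zx = zy` then `xw = yw` for some central `w`
    (∀ x y z : StructureMonoid lam rho, (x * z = y * z ∨ z * x = z * y) →
      ∃ w : StructureMonoid lam rho, (∀ u, u * w = w * u) ∧ x * w = y * w) ∧
    -- `M` is left cancellative iff it is right cancellative
    ((∀ a b c : StructureMonoid lam rho, c * a = c * b → a = b) ↔
      (∀ a b c : StructureMonoid lam rho, a * c = b * c → a = b)) ∧
    -- `η_M = {(x,y) : xz = yz for some z}` is the cancellative congruence of `M`:
    -- the smallest congruence whose quotient is cancellative
    (∃ c : Con (StructureMonoid lam rho),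
      (∀ x y, c x y ↔ ∃ z, x * z = y * z) ∧
      (∀ a b u : c.Quotient, (a * u = b * u → a = b) ∧ (u * a = u * b → a = b)) ∧
      (∀ c' : Con (StructureMonoid lam rho),
        (∀ a b u : c'.Quotient, (a * u = b * u → a = b) ∧ (u * a = u * b → a = b)) →
        c ≤ c')) := by
  have main := stmt15_main lam rho hYB1 hYB2 hbij
  refine ⟨main, ⟨?_, ?_⟩, ?_⟩
  · intro hl a b c hc
    obtain ⟨w, hw, h⟩ := main a b c (Or.inl hc)
    rw [hw, hw] at h
    exact hl _ _ _ h
  · intro hr a b c hc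
    obtain ⟨w, hw, h⟩ := main a b c (Or.inr hc)
    exact hr _ _ _ h
  · have hcen : ∀ x y : StructureMonoid lam rho, (∃ z, x * z = y * z) →
        ∃ w : StructureMonoid lam rho, (∀ u, u * w = w * u) ∧ x * w = y * w :=
      fun x y ⟨z, hz⟩ => main x y z (Or.inl hz)
    let c : Con (StructureMonoid lam rho) :=
      { r := fun x y => ∃ z, x * z = y * z
        iseqv := by
          refine ⟨fun x => ⟨1, rfl⟩, fun ⟨z, hz⟩ => ⟨z, hz.symm⟩, ?_⟩
          intro x y t h1 h2
          obtain ⟨w, hw, h1⟩ := hcen _ _ h1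
          obtain ⟨v, hv, h2⟩ := hcen _ _ h2
          refine ⟨w * v, ?_⟩
          rw [← mul_assoc, h1, mul_assoc, hv, ← mul_assoc, h2, mul_assoc, ← hv]
        mul' := by
          intro a b a' b' h1 h2
          obtain ⟨w, hw, h1⟩ := hcen _ _ h1
          obtain ⟨v, hv, h2⟩ := hcen _ _ h2
          refine ⟨v * w, ?_⟩
          calc a * a' * (v * w) = a * (a' * v) * w := by simp only [mul_assoc]
            _ = a * (b' * v) * w := by rw [h2]
            _ = a * w * (b' * v) := by rw [mul_assoc, hw, mul_assoc]
            _ = b * w * (b' * v) := by rw [h1]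
            _ = b * ((b' * v) * w) := by rw [mul_assoc, ← hw]
            _ = b * b' * (v * w) := by simp only [mul_assoc] }
    have hc : ∀ x y, c x y ↔ ∃ z, x * z = y * z := fun x y => Iff.rfl
    refine ⟨c, hc, ?_, ?_⟩
    · intro a b u
      induction a using Con.induction_on with | _ a =>
      induction b using Con.induction_on with | _ b =>
      induction u using Con.induction_on with | _ u =>
      rw [← Con.coe_mul, ← Con.coe_mul, ← Con.coe_mul, ← Con.coe_mul, Con.eq, Con.eq, Con.eq,
        hc, hc, hc]
      constructor
      · rintro ⟨z, hz⟩
        exact ⟨u * z, by simpa only [mul_assoc] using hz⟩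
      · rintro ⟨z, hz⟩
        obtain ⟨w, hw, h⟩ := main (a * z) (b * z) u (Or.inr (by simpa only [mul_assoc] using hz))
        exact ⟨z * w, by simpa only [mul_assoc] using h⟩
    · intro c' hc' x y hxy
      obtain ⟨z, hz⟩ := (hc x y).1 hxy
      have := (hc' (x : c'.Quotient) (y : c'.Quotient) (z : c'.Quotient)).1
        (by rw [← Con.coe_mul, ← Con.coe_mul, hz])
      exact (Con.eq c').1 this
end

section
/- Let (X,r) be a finite bijective left non-degenerate solution, M = M(X,r), and K a field. Then the following are equivalent: (1) (X,r) is involutive; (2) M is a cancellative monoid; (3) K[M] is a domain; (4) K[M] is a prime algebra. In particular, cancellativity of M implies cancellativity of the derived monoid A(X,r), resolving the Gateva-Ivanova cancellativity conjecture (without the square-free hypothesis). -/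
namespace HS

/-- Forward difference. -/
def dl (f : ℕ → ℤ) : ℕ → ℤ := fun d => f (d + 1) - f d

lemma dl_iter_sub (k : ℕ) (f g : ℕ → ℤ) :
    dl^[k] (fun d => f d - g d) = fun d => dl^[k] f d - dl^[k] g d := by
  induction k generalizing f g with
  | zero => rfl
  | succ k ih =>
    simp only [Function.iterate_succ, Function.comp]
    rw [← ih]
    congr 1
    funext d
    simp only [dl]; ring

lemma dl_iter_add (k : ℕ) (f g : ℕ → ℤ) :
    dl^[k] (fun d => f d + g d) = fun d => dl^[k] f d + dl^[k] g d := by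
  induction k generalizing f g with
  | zero => rfl
  | succ k ih =>
    simp only [Function.iterate_succ, Function.comp]
    rw [← ih]
    congr 1
    funext d
    simp only [dl]; ring

lemma dl_iter_mul (k : ℕ) (c : ℤ) (f : ℕ → ℤ) :
    dl^[k] (fun d => c * f d) = fun d => c * dl^[k] f d := by
  induction k generalizing f with
  | zero => rfl
  | succ k ih =>
    simp only [Function.iterate_succ, Function.comp]
    rw [← ih]
    congr 1
    funext d
    simp only [dl]; ring

lemma dl_iter_shift (k j : ℕ) (f : ℕ → ℤ) :
    dl^[k] (fun d => f (d + j)) = fun d => dl^[k] f (d + j) := by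
  induction k generalizing f with
  | zero => rfl
  | succ k ih =>
    simp only [Function.iterate_succ, Function.comp]
    rw [← ih]
    congr 1
    funext d
    simp only [dl]
    rw [Nat.add_right_comm]

/-- The `k`-th difference is eventually zero. -/
def E (k : ℕ) (f : ℕ → ℤ) : Prop := ∃ N, ∀ d ≥ N, dl^[k] f d = 0

lemma E_step (k : ℕ) (f g h : ℕ → ℤ) (hg : E k g) (hh : E k h)
    (H : ∀ d, f (d + 1) - f d = g (d + 1) - h d) : E (k + 1) f := by
  obtain ⟨N, hN⟩ := hg
  obtain ⟨N', hN'⟩ := hh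
  refine ⟨N + N', fun d hd => ?_⟩
  have : dl f = fun d => g (d + 1) - h d := funext H
  rw [Function.iterate_succ, Function.comp, this, dl_iter_sub k (fun d => g (d + 1)) h,
    dl_iter_shift]
  simp only
  rw [hN _ (by omega), hN' _ (by omega)]; rfl

lemma ev_neg (k : ℕ) (f : ℕ → ℤ) (h : ∃ N, ∀ d ≥ N, dl^[k] f d ≤ -1) :
    ∃ N, ∀ d ≥ N, f d ≤ -1 := by
  induction k generalizing f with
  | zero => exact h
  | succ k ih =>
    obtain ⟨N, hN⟩ := ih (dl f) h
    have key : ∀ t : ℕ, f (N + t) ≤ f N - t := by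
      intro t
      induction t with
      | zero => simp
      | succ t iht =>
        have := hN (N + t) (by omega)
        simp only [dl] at this
        push_cast
        rw [← add_assoc]
        linarith
    refine ⟨N + (f N).toNat + 1, fun d hd => ?_⟩
    obtain ⟨t, rfl⟩ : ∃ t, d = N + t := ⟨d - N, by omega⟩
    have := key t
    omega

lemma ev_const (k : ℕ) (f : ℕ → ℤ) (h : E (k + 1) f) :
    ∃ e : ℤ, ∃ N, ∀ d ≥ N, dl^[k] f d = e := by
  obtain ⟨N, hN⟩ := h
  refine ⟨dl^[k] f N, N, fun d hd => ?_⟩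
  induction d, hd using Nat.le_induction with
  | base => rfl
  | succ d hd ih =>
    have := hN d hd
    rw [Function.iterate_succ_apply'] at this
    simp only [dl] at this
    linarith

lemma dl_multichoose (k : ℕ) (d : ℕ) :
    dl^[k] (fun d => ((Nat.multichoose (k + 1) d : ℕ) : ℤ)) d = 1 := by
  induction k generalizing d with
  | zero => simp [Nat.multichoose_one]
  | succ k ih =>
    rw [Function.iterate_succ, Function.comp]
    have : dl (fun d => ((Nat.multichoose (k + 1 + 1) d : ℕ) : ℤ)) =
        fun d => ((Nat.multichoose (k + 1) (d + 1) : ℕ) : ℤ) := by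
      funext d
      simp only [dl]
      rw [Nat.multichoose_succ_succ]
      push_cast; ring
    rw [this, dl_iter_shift k 1 (fun d => ((Nat.multichoose (k + 1) d : ℕ) : ℤ))]
    exact ih _

section hilbert

lemma fr_congr {K B : Type*} [Field K] [AddCommGroup B] [Module K B] {P Q : Submodule K B}
    (h : P = Q) : Module.finrank K P = Module.finrank K Q := by
  subst h; rfl

variable {X K B : Type*} [Field K] [AddCommGroup B]
  [Module (MvPolynomial X K) B] [Module K B] [IsScalarTower K (MvPolynomial X K) B]

/-- `K`-linear multiplication by a variable. -/
noncomputable def mx (K B : Type*) [Field K] [AddCommGroup B]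
  [Module (MvPolynomial X K) B] [Module K B] [IsScalarTower K (MvPolynomial X K) B]
  (i : X) : B →ₗ[K] B where
  toFun b := (MvPolynomial.X i : MvPolynomial X K) • b
  map_add' := smul_add _
  map_smul' c b := by
    simp only [RingHom.id_apply]
    rw [← algebraMap_smul (MvPolynomial X K) c b, ← algebraMap_smul (MvPolynomial X K) c
      ((MvPolynomial.X i : MvPolynomial X K) • b), smul_smul, smul_smul, mul_comm]

/-- Submodules from `K`-submodules that are closed under multiplication by the variables. -/
noncomputable def mkSub (W : Submodule K B) (h : ∀ i, ∀ b ∈ W, mx (X := X) K B i b ∈ W) :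
    Submodule (MvPolynomial X K) B where
  carrier := W
  add_mem' := W.add_mem
  zero_mem' := W.zero_mem
  smul_mem' p b hb := by
    change b ∈ W at hb
    change p • b ∈ W
    induction p using MvPolynomial.induction_on with
    | C a =>
      have := W.smul_mem a hb
      rwa [← algebraMap_smul (MvPolynomial X K) a b] at this
    | add p q hp hq => rw [add_smul]; exact W.add_mem hp hq
    | mul_X p i hp => rw [mul_comm, mul_smul]; exact h i _ hp

/-- Hilbert function. -/
noncomputable def hf (pr : ℕ → B →ₗ[K] B) (W : Submodule (MvPolynomial X K) B) (d : ℕ) : ℤ :=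
  (Module.finrank K ((W.restrictScalars K).map (pr d)) : ℤ)

/-- Homogeneous submodules. -/
def Hom (pr : ℕ → B →ₗ[K] B) (W : Submodule (MvPolynomial X K) B) : Prop :=
  ∀ d, ∀ w ∈ W, pr d w ∈ W

variable (pr : ℕ → B →ₗ[K] B)
  (hpp : ∀ d b, pr d (pr d b) = pr d b)
  (hx : ∀ d i b, pr (d + 1) (mx (X := X) K B i b) = mx (X := X) K B i (pr d b))
  (hx0 : ∀ i b, pr 0 (mx (X := X) K B i b) = 0)
  (hfin : ∀ b, ∃ N, ∀ d ≥ N, pr d b = 0)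
  (hfd : ∀ d, Module.Finite K (LinearMap.range (pr d)))

include hfd in
lemma fd_map (W : Submodule K B) (d : ℕ) : Module.Finite K (W.map (pr d)) := by
  have := hfd d
  exact Submodule.finiteDimensional_of_le (LinearMap.map_le_range)

/-- transporter submodule -/
noncomputable def trN (W W' : Submodule (MvPolynomial X K) B) (i : X) :
    Submodule (MvPolynomial X K) B :=
  W ⊓ W'.comap (LinearMap.lsmul (MvPolynomial X K) B (MvPolynomial.X i))

noncomputable def trC (W W' : Submodule (MvPolynomial X K) B) (i : X) :
    Submodule (MvPolynomial X K) B :=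
  W' ⊔ W.map (LinearMap.lsmul (MvPolynomial X K) B (MvPolynomial.X i))

include hpp in
lemma map_pr_mem (W : Submodule (MvPolynomial X K) B) (hW : Hom pr W) (d : ℕ) (b : B) :
    b ∈ (W.restrictScalars K).map (pr d) ↔ b ∈ W ∧ pr d b = b := by
  constructor
  · rintro ⟨w, hw, rfl⟩
    exact ⟨hW d w hw, hpp d w⟩
  · rintro ⟨h1, h2⟩
    exact ⟨b, h1, h2⟩

include hx in
lemma hom_trN (W W' : Submodule (MvPolynomial X K) B) (hW : Hom pr W) (hW' : Hom pr W') (i : X) :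
    Hom pr (trN W W' i) := by
  intro d w hw
  refine ⟨hW d w hw.1, ?_⟩
  have h := hW' (d + 1) _ hw.2
  have := hx d i w
  change pr (d + 1) (mx (X := X) K B i w) ∈ W' at h
  rw [this] at h
  exact h

include hx hx0 in
lemma hom_trC (W W' : Submodule (MvPolynomial X K) B) (hW : Hom pr W) (hW' : Hom pr W') (i : X) :
    Hom pr (trC W W' i) := by
  intro d w hw
  obtain ⟨a, ha, _, ⟨b, hb, rfl⟩, rfl⟩ := Submodule.mem_sup.1 hw
  rw [map_add]
  refine Submodule.add_mem _ (Submodule.mem_sup_left (hW' d a ha)) ?_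
  change pr d (mx (X := X) K B i b) ∈ _
  cases d with
  | zero => rw [hx0]; exact zero_mem _
  | succ d =>
    rw [hx]
    exact Submodule.mem_sup_right ⟨_, hW d b hb, rfl⟩

include hpp hx hx0 hfd in
lemma count (W W' : Submodule (MvPolynomial X K) B) (hW : Hom pr W) (hW' : Hom pr W') (i : X)
    (d : ℕ) :
    hf pr W d - hf pr (trN W W' i) d = hf pr (trC W W' i) (d + 1) - hf pr W' (d + 1) := by
  have hN := hom_trN pr hx W W' hW hW' i
  have hC := hom_trC pr hx hx0 W W' hW hW' i
  set Wd := (W.restrictScalars K).map (pr d) with hWd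
  set Nd := ((trN W W' i).restrictScalars K).map (pr d) with hNd
  set Cd := ((trC W W' i).restrictScalars K).map (pr (d + 1)) with hCd
  set Vd := (W'.restrictScalars K).map (pr (d + 1)) with hVd
  have f1 : Module.Finite K Wd := fd_map pr hfd _ d
  have f2 : Module.Finite K Nd := fd_map pr hfd _ d
  have f3 : Module.Finite K Cd := fd_map pr hfd _ _
  have f4 : Module.Finite K Vd := fd_map pr hfd _ _
  have e1 : Vd ⊔ Wd.map (mx (X := X) K B i) = Cd := by
    apply le_antisymm
    · refine sup_le ?_ ?_
      · intro b hb
        rw [hVd, map_pr_mem pr hpp W' hW'] at hb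
        rw [hCd, map_pr_mem pr hpp _ hC]
        exact ⟨Submodule.mem_sup_left hb.1, hb.2⟩
      · rintro _ ⟨b, hb, rfl⟩
        rw [SetLike.mem_coe, hWd, map_pr_mem pr hpp W hW] at hb
        rw [hCd, map_pr_mem pr hpp _ hC]
        refine ⟨Submodule.mem_sup_right ⟨b, hb.1, rfl⟩, ?_⟩
        rw [hx, hb.2]
    · rintro _ ⟨c, hc, rfl⟩
      obtain ⟨a, ha, _, ⟨b, hb, rfl⟩, rfl⟩ := Submodule.mem_sup.1 hc
      rw [map_add]
      refine Submodule.add_mem _ (Submodule.mem_sup_left ⟨a, ha, rfl⟩)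
        (Submodule.mem_sup_right ?_)
      change pr (d + 1) (mx (X := X) K B i b) ∈ _
      rw [hx]
      exact ⟨_, ⟨b, hb, rfl⟩, rfl⟩
  have e2 : Vd ⊓ Wd.map (mx (X := X) K B i) = Nd.map (mx (X := X) K B i) := by
    ext c
    constructor
    · rintro ⟨h1, b, hb, rfl⟩
      rw [SetLike.mem_coe, hWd, map_pr_mem pr hpp W hW] at hb
      rw [SetLike.mem_coe, hVd, map_pr_mem pr hpp W' hW'] at h1
      refine ⟨b, ?_, rfl⟩
      rw [SetLike.mem_coe, hNd, map_pr_mem pr hpp _ hN]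
      exact ⟨⟨hb.1, h1.1⟩, hb.2⟩
    · rintro ⟨b, hb, rfl⟩
      rw [SetLike.mem_coe, hNd, map_pr_mem pr hpp _ hN] at hb
      refine ⟨?_, b, ?_, rfl⟩
      · rw [SetLike.mem_coe, hVd, map_pr_mem pr hpp W' hW']
        refine ⟨hb.1.2, ?_⟩
        rw [hx, hb.2]
      · rw [SetLike.mem_coe, hWd, map_pr_mem pr hpp W hW]
        exact ⟨hb.1.1, hb.2⟩
  have hNW : Nd ≤ Wd := by
    rw [hNd, hWd]
    exact Submodule.map_mono (fun x hx => hx.1)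
  have r0 := Submodule.finrank_sup_add_finrank_inf_eq Vd (Wd.map (mx (X := X) K B i))
  have r1 := LinearMap.finrank_range_add_finrank_ker ((mx (X := X) K B i).domRestrict Wd)
  have r2 := LinearMap.finrank_range_add_finrank_ker ((mx (X := X) K B i).domRestrict Nd)
  rw [LinearMap.range_domRestrict] at r1 r2
  have k1 : Module.finrank K (LinearMap.ker ((mx (X := X) K B i).domRestrict Wd)) =
      Module.finrank K (LinearMap.ker ((mx (X := X) K B i).domRestrict Nd)) := by
    rw [← Submodule.finrank_map_subtype_eq Wd, ← Submodule.finrank_map_subtype_eq Nd]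
    apply fr_congr
    ext b
    simp only [Submodule.mem_map, LinearMap.mem_ker, Submodule.subtype_apply, Subtype.exists,
      LinearMap.domRestrict_apply, exists_and_right, exists_eq_right]
    constructor
    · rintro ⟨hb, h0⟩
      refine ⟨?_, h0⟩
      rw [hWd, map_pr_mem pr hpp W hW] at hb
      rw [hNd, map_pr_mem pr hpp _ hN]
      refine ⟨⟨hb.1, ?_⟩, hb.2⟩
      change mx (X := X) K B i b ∈ W'
      rw [h0]; exact zero_mem _
    · rintro ⟨hb, h0⟩
      exact ⟨hNW hb, h0⟩
  rw [e1, e2] at r0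
  change ((Module.finrank K Wd : ℕ) : ℤ) - (Module.finrank K Nd : ℕ) =
    (Module.finrank K Cd : ℕ) - (Module.finrank K Vd : ℕ)
  omega

include hpp hx hx0 hfin hfd in
lemma hilbert_aux [IsNoetherian (MvPolynomial X K) B] [DecidableEq X] (I : Finset X) :
    ∀ W W' : Submodule (MvPolynomial X K) B, Hom pr W → Hom pr W' → W' ≤ W →
      (∀ i, i ∉ I → ∀ w ∈ W, (MvPolynomial.X i : MvPolynomial X K) • w ∈ W') →
      E I.card (fun d => hf pr W d - hf pr W' d) := by
  induction I using Finset.induction_on with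
  | empty =>
    intro W W' hW hW' hle h
    obtain ⟨s, hs⟩ := (isNoetherian_def.1 ‹_›) W
    have hfs : ∃ N, ∀ u ∈ s, ∀ d ≥ N, pr d u = 0 := by
      choose N hN using hfin
      refine ⟨s.sup N, fun u hu d hd => hN u d (le_trans (Finset.le_sup hu) hd)⟩
    obtain ⟨N, hN⟩ := hfs
    have key : ∀ w ∈ W, ∀ d ≥ N, pr d w ∈ W' := by
      intro w hw d hd
      have hw0 := hw
      rw [← hs] at hw
      induction hw using Submodule.span_induction with
      | mem u hu => rw [hN u hu d hd]; exact zero_mem _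
      | zero => rw [map_zero]; exact zero_mem _
      | add a b ha hb iha ihb =>
        rw [hs] at ha hb
        rw [map_add]; exact add_mem (iha ha) (ihb hb)
      | smul p b hb ih =>
        rw [hs] at hb
        have ih := ih hb
        clear hw0
        induction p using MvPolynomial.induction_on with
        | C a =>
          have : (MvPolynomial.C a : MvPolynomial X K) • b = a • b :=
            algebraMap_smul (MvPolynomial X K) a b
          rw [this, map_smul, ← algebraMap_smul (MvPolynomial X K) a (pr d b)]
          exact W'.smul_mem _ ih
        | add p q hp hq => rw [add_smul, map_add]; exact add_mem hp hq
        | mul_X p i hp =>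
          rw [mul_comm, mul_smul]
          exact hW' d _ (h i (by simp) _ (W.smul_mem _ hb))
    refine ⟨N, fun d hd => ?_⟩
    simp only [Finset.card_empty, Function.iterate_zero, id]
    have : (W.restrictScalars K).map (pr d) = (W'.restrictScalars K).map (pr d) := by
      apply le_antisymm
      · rintro _ ⟨w, hw, rfl⟩
        exact ⟨pr d w, key w hw d hd, hpp d w⟩
      · exact Submodule.map_mono hle
    rw [hf, hf, fr_congr this, sub_self]
  | insert i I hi ih =>
    intro W W' hW hW' hle h
    rw [Finset.card_insert_of_notMem hi]
    have hN := hom_trN pr hx W W' hW hW' i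
    have hC := hom_trC pr hx hx0 W W' hW hW' i
    refine E_step _ _ (fun d => hf pr W d - hf pr (trC W W' i) d)
      (fun d => hf pr (trN W W' i) d - hf pr W' d) (ih _ _ hW hC ?_ ?_) (ih _ _ hN hW' ?_ ?_) ?_
    · refine sup_le hle ?_
      rintro _ ⟨w, hw, rfl⟩
      exact W.smul_mem _ hw
    · intro j hj w hw
      by_cases hji : j = i
      · subst hji
        exact Submodule.mem_sup_right ⟨w, hw, rfl⟩
      · exact Submodule.mem_sup_left (h j (by simp [hji, hj]) w hw)
    · intro w hw
      exact ⟨hle hw, W'.smul_mem _ hw⟩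
    · intro j hj w hw
      by_cases hji : j = i
      · subst hji
        exact hw.2
      · exact h j (by simp [hji, hj]) w hw.1
    · intro d
      have := count pr hpp hx hx0 hfd W W' hW hW' i d
      linarith

include hpp hx hx0 hfin hfd in
lemma hilbert [IsNoetherian (MvPolynomial X K) B] [Fintype X]
    (W : Submodule (MvPolynomial X K) B) (hW : Hom pr W) :
    E (Fintype.card X) (hf pr W) := by
  classical
  have := hilbert_aux pr hpp hx hx0 hfin hfd Finset.univ W ⊥ hW
    (by intro d w hw; rw [(Submodule.mem_bot _).1 hw, map_zero]; exact zero_mem _) bot_le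
    (by intro i hi; simp at hi)
  rw [Finset.card_univ] at this
  have h0 : ∀ d, hf pr (⊥ : Submodule (MvPolynomial X K) B) d = 0 := by
    intro d
    have e : ((⊥ : Submodule (MvPolynomial X K) B).restrictScalars K).map (pr d) = ⊥ := by simp
    rw [hf, fr_congr e, finrank_bot]; rfl
  simpa only [h0, sub_zero] using this

end hilbert
end HS

namespace Coc

open Finsupp in
lemma mapDomain_mul {X : Type*} (g h : Equiv.Perm X) (a : X →₀ ℕ) :
    mapDomain (g * h) a = mapDomain g (mapDomain h a) := by
  rw [← mapDomain_comp]; rfl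

lemma mapDomain_inv_self {X : Type*} (g : Equiv.Perm X) (a : X →₀ ℕ) :
    Finsupp.mapDomain (g⁻¹ : Equiv.Perm X) (Finsupp.mapDomain g a) = a := by
  rw [← mapDomain_mul, inv_mul_cancel]; exact Finsupp.mapDomain_id

lemma mapDomain_self_inv {X : Type*} (g : Equiv.Perm X) (a : X →₀ ℕ) :
    Finsupp.mapDomain g (Finsupp.mapDomain (g⁻¹ : Equiv.Perm X) a) = a := by
  rw [← mapDomain_mul, mul_inv_cancel]; exact Finsupp.mapDomain_id

lemma mapDomain_one' {X : Type*} (a : X →₀ ℕ) :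
    Finsupp.mapDomain (1 : Equiv.Perm X) a = a := Finsupp.mapDomain_id

section comb

variable {X M : Type*} [Finite X] [Monoid M] (φ : M →* Equiv.Perm X) (π : M ≃ (X →₀ ℕ))
  (hπ : ∀ m n, π (m * n) = π m + (π n).mapDomain (φ m))

lemma exists_pow (m : M) : ∃ n : M, φ (n * m) = 1 ∧ φ (m * n) = 1 ∧ n * m = m * n := by
  have : Finite (Equiv.Perm X) := inferInstance
  have h := orderOf_pos (φ m)
  refine ⟨m ^ (orderOf (φ m) - 1), ?_, ?_, ?_⟩
  · rw [← pow_succ, Nat.sub_add_cancel h, map_pow, pow_orderOf_eq_one]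
  · rw [← pow_succ', Nat.sub_add_cancel h, map_pow, pow_orderOf_eq_one]
  · rw [← pow_succ, ← pow_succ']

include hπ in
lemma beta_inj : Function.Injective
    (fun p : Equiv.Perm X × M => (p.1 * φ p.2, (π p.2).mapDomain p.1)) := by
  rintro ⟨g, m⟩ ⟨h, n⟩ H
  simp only [Prod.mk.injEq] at H
  obtain ⟨h1, h2⟩ := H
  have h3 : (π m).mapDomain ((φ m)⁻¹ : Equiv.Perm X) = (π n).mapDomain ((φ n)⁻¹ : Equiv.Perm X) := by
    have e1 : (φ m)⁻¹ = (g * φ m)⁻¹ * g := by group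
    have e2 : (φ n)⁻¹ = (g * φ m)⁻¹ * h := by rw [h1]; group
    rw [e1, e2, mapDomain_mul, mapDomain_mul, h2]
  obtain ⟨m', hm1, hm2, hm3⟩ := exists_pow φ m
  obtain ⟨n', hn1, hn2, hn3⟩ := exists_pow φ n
  have comm : (n' * n) * (m' * m) = (m' * m) * (n' * n) := by
    apply π.injective
    rw [hπ (n' * n) (m' * m), hπ (m' * m) (n' * n), hm1, hn1, mapDomain_one', mapDomain_one',
      add_comm]
  have k1 : φ (n' * n * m') = (φ m)⁻¹ := by
    rw [map_mul, hn1, one_mul, eq_inv_iff_mul_eq_one, ← map_mul, hm1]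
  have k2 : φ (m' * m * n') = (φ n)⁻¹ := by
    rw [map_mul, hm1, one_mul, eq_inv_iff_mul_eq_one, ← map_mul, hn1]
  have k3 : π (n' * n * m') = π (m' * m * n') := by
    have := congrArg π comm
    rw [← mul_assoc, ← mul_assoc _ n' n, hπ, hπ (m' * m * n') n, k1, k2, h3] at this
    exact add_right_cancel this
  have k4 := π.injective k3
  have k5 : φ m = φ n := by
    rw [k4, k2] at k1
    exact (inv_injective k1).symm
  have k6 : π m = π n := by
    rw [k5] at h3
    exact Finsupp.mapDomain_injective (Equiv.injective _) h3
  have k7 := π.injective k6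
  subst k7
  simp only [mul_left_inj] at h1
  rw [h1]

include hπ in
lemma beta_surj : Function.Surjective
    (fun p : Equiv.Perm X × M => (p.1 * φ p.2, (π p.2).mapDomain p.1)) := by
  rintro ⟨g, a⟩
  set b := a.mapDomain (g⁻¹ : Equiv.Perm X) with hb
  obtain ⟨n, h1, h2, h3⟩ := exists_pow φ (π.symm b)
  set c := π.symm b * n with hc
  have hle : b ≤ π c := by
    rw [hc, hπ, Equiv.apply_symm_apply]; exact le_self_add
  set m' := π.symm (π c - b) with hm'
  set m := π.symm (b.mapDomain ((φ m')⁻¹ : Equiv.Perm X)) with hm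
  have hm2 : π m = b.mapDomain ((φ m')⁻¹ : Equiv.Perm X) := π.apply_symm_apply _
  have hm1 : π m' = π c - b := π.apply_symm_apply _
  have e : m' * m = c := by
    apply π.injective
    rw [hπ, hm2, mapDomain_self_inv, hm1, tsub_add_cancel_of_le hle]
  have e2 : φ m = (φ m')⁻¹ := by
    rw [eq_comm, inv_eq_iff_mul_eq_one, ← map_mul, e, h2]
  refine ⟨(g * (φ m)⁻¹, m), ?_⟩
  simp only [inv_mul_cancel_right, Prod.mk.injEq, true_and]
  rw [mapDomain_mul, hm2, ← e2, mapDomain_inv_self, hb, mapDomain_self_inv]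

/-- The bijection between `G × M` and `G × ℕ^X`. -/
noncomputable def beta : Equiv.Perm X × M ≃ Equiv.Perm X × (X →₀ ℕ) :=
  Equiv.ofBijective _ ⟨beta_inj φ π hπ, beta_surj φ π hπ⟩

lemma beta_apply (g : Equiv.Perm X) (m : M) :
    beta φ π hπ (g, m) = (g * φ m, (π m).mapDomain g) := rfl

variable (K : Type*) [Field K]

/-- The linear equivalence `(G → K[ℕ^X]) ≃ (G → K[M])`. -/
noncomputable def Xi :
    (Equiv.Perm X → MvPolynomial X K) ≃ₗ[K] (Equiv.Perm X → MonoidAlgebra K M) :=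
  (LinearEquiv.piCongrRight (fun _ => AddMonoidAlgebra.coeffLinearEquiv K)).trans <|
  (Finsupp.linearEquivFunOnFinite K ((X →₀ ℕ) →₀ K) (Equiv.Perm X)).symm.trans <|
  (Finsupp.curryLinearEquiv K).symm.trans <|
  (Finsupp.domLCongr (beta φ π hπ).symm).trans <|
  (Finsupp.curryLinearEquiv K).trans <|
  (Finsupp.linearEquivFunOnFinite K (M →₀ K) (Equiv.Perm X)).trans <|
  (LinearEquiv.piCongrRight (fun _ => (MonoidAlgebra.coeffLinearEquiv K).symm))

lemma Xi_coeff (b : Equiv.Perm X → MvPolynomial X K) (g : Equiv.Perm X) (m : M) :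
    (Xi φ π hπ K b g).coeff m = MvPolynomial.coeff ((π m).mapDomain g) (b (g * φ m)) := by
  simp [Xi, beta_apply]
  rfl

end comb
end Coc

namespace Coc

section polys
open MvPolynomial
variable {X : Type*} [Fintype X] (K : Type*) [Field K]

lemma finrank_hom (d : ℕ) :
    Module.finrank K (homogeneousSubmodule X K d) = (Fintype.card X).multichoose d := by
  classical
  have h1 := HS.fr_congr (homogeneousSubmodule_eq_finsupp_supported X K d)
  rw [h1, (AddMonoidAlgebra.supportedEquivFinsupp (R := K) (S := K)
    {e : X →₀ ℕ | Finsupp.degree e = d}).finrank_eq]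
  let eqv : Sym X d ≃ {e : X →₀ ℕ | Finsupp.degree e = d} := Sym.equivNatSum X d
  let _ : Fintype {e : X →₀ ℕ | Finsupp.degree e = d} := Fintype.ofEquiv _ eqv
  rw [Module.finrank_finsupp_self, ← Sym.card_sym_eq_multichoose X d]
  exact (Fintype.card_congr eqv).symm

lemma finite_hom (d : ℕ) : Module.Finite K (homogeneousSubmodule X K d) :=
  Module.Finite.iff_fg.2 (homogeneousSubmodule_fg X K d)

lemma hc_X_mul (d : ℕ) (i : X) (p : MvPolynomial X K) :
    homogeneousComponent (d + 1) (MvPolynomial.X i * p) =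
      MvPolynomial.X i * homogeneousComponent d p := by
  classical
  ext m
  rw [coeff_homogeneousComponent, coeff_X_mul', coeff_X_mul']
  by_cases h : i ∈ m.support
  · rw [if_pos h, if_pos h, coeff_homogeneousComponent]
    have : Finsupp.degree m = Finsupp.degree (m - Finsupp.single i 1) + 1 := by
      have hle : Finsupp.single i 1 ≤ m := by
        rw [Finsupp.single_le_iff]
        have := Finsupp.mem_support_iff.1 h
        omega
      conv_lhs => rw [← tsub_add_cancel_of_le hle]
      rw [map_add, Finsupp.degree_single]
    rw [this]
    simp
  · rw [if_neg h, if_neg h]; simp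

lemma hc_X_mul_zero (i : X) (p : MvPolynomial X K) :
    homogeneousComponent 0 (MvPolynomial.X i * p) = 0 := by
  classical
  ext m
  rw [coeff_homogeneousComponent, coeff_X_mul']
  split_ifs with h1 h2
  · rw [Finsupp.degree_eq_zero_iff] at h1
    subst h1; simp at h2
  · simp
  · simp

/-- homogeneous components -/
noncomputable def pr (d : ℕ) :
    (Equiv.Perm X → MvPolynomial X K) →ₗ[K] (Equiv.Perm X → MvPolynomial X K) :=
  (homogeneousComponent d).compLeft (Equiv.Perm X)

lemma pr_apply (d : ℕ) (b : Equiv.Perm X → MvPolynomial X K) (g) :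
    pr K d b g = homogeneousComponent d (b g) := rfl

lemma pr_pp (d : ℕ) (b : Equiv.Perm X → MvPolynomial X K) : pr K d (pr K d b) = pr K d b := by
  funext g
  rw [pr_apply, pr_apply, homogeneousComponent_of_mem (homogeneousComponent_isHomogeneous _ _)]
  simp

lemma pr_x (d : ℕ) (i : X) (b : Equiv.Perm X → MvPolynomial X K) :
    pr K (d + 1) (HS.mx (X := X) K _ i b) = HS.mx (X := X) K _ i (pr K d b) := by
  funext g
  exact hc_X_mul K d i (b g)

lemma pr_x0 (i : X) (b : Equiv.Perm X → MvPolynomial X K) :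
    pr K 0 (HS.mx (X := X) K _ i b) = 0 := by
  funext g
  exact hc_X_mul_zero K i (b g)

lemma pr_fin (b : Equiv.Perm X → MvPolynomial X K) : ∃ N, ∀ d ≥ N, pr K d b = 0 := by
  classical
  refine ⟨(∑ g, (b g).totalDegree) + 1, fun d hd => ?_⟩
  funext g
  rw [pr_apply, homogeneousComponent_eq_zero]; · rfl
  have := Finset.single_le_sum (f := fun g => (b g).totalDegree) (fun _ _ => Nat.zero_le _)
    (Finset.mem_univ g)
  omega

lemma range_pr (d : ℕ) : LinearMap.range (pr (X := X) K d) =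
    LinearMap.range ((homogeneousSubmodule X K d).subtype.compLeft (Equiv.Perm X)) := by
  ext b
  constructor
  · rintro ⟨b, rfl⟩
    exact ⟨fun g => ⟨_, homogeneousComponent_isHomogeneous d (b g)⟩, rfl⟩
  · rintro ⟨b, rfl⟩
    refine ⟨fun g => (b g : MvPolynomial X K), ?_⟩
    funext g
    rw [pr_apply, homogeneousComponent_of_mem (b g).2]
    simp

lemma pr_fd (d : ℕ) : Module.Finite K (LinearMap.range (pr (X := X) K d)) := by
  have := finite_hom (X := X) K d
  rw [range_pr]
  infer_instance

lemma finrank_range_pr (d : ℕ) : Module.finrank K (LinearMap.range (pr (X := X) K d)) =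
    Nat.card (Equiv.Perm X) * (Fintype.card X).multichoose d := by
  classical
  have := finite_hom (X := X) K d
  rw [HS.fr_congr (range_pr K d), LinearMap.finrank_range_of_inj, Module.finrank_pi_fintype,
    finrank_hom]
  · simp
  · intro a b h
    funext g
    exact Subtype.ext (congrFun h g)

lemma hilbertB (W : Submodule (MvPolynomial X K) (Equiv.Perm X → MvPolynomial X K))
    (hW : HS.Hom (pr K) W) : HS.E (Fintype.card X) (HS.hf (pr K) W) :=
  HS.hilbert (pr K) (pr_pp K) (pr_x K) (pr_x0 K) (pr_fin K) (pr_fd K) W hW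

lemma lower (W : Submodule (MvPolynomial X K) (Equiv.Perm X → MvPolynomial X K))
    (hW : HS.Hom (pr K) W) (hne : W ≠ ⊥) :
    ∃ j, ∀ d, ((Fintype.card X).multichoose d : ℤ) ≤ HS.hf (pr K) W (d + j) := by
  obtain ⟨b, hb, hb0⟩ := W.ne_bot_iff.1 hne
  obtain ⟨g, hg⟩ : ∃ g, b g ≠ 0 := by
    by_contra! h; exact hb0 (funext h)
  obtain ⟨m, hm⟩ : ∃ m, coeff m (b g) ≠ 0 := by
    by_contra! h; exact hg (MvPolynomial.ext _ _ (by simpa using h))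
  refine ⟨Finsupp.degree m, fun d => ?_⟩
  set j := Finsupp.degree m with hj
  set c := pr K j b with hc
  have hcW : c ∈ W := hW j b hb
  have hcg : c g ≠ 0 := by
    intro h
    apply hm
    have := congrArg (coeff m) h
    rw [hc, pr_apply, coeff_homogeneousComponent, if_pos hj.symm] at this
    simpa using this
  let T : MvPolynomial X K →ₗ[K] (Equiv.Perm X → MvPolynomial X K) :=
    (LinearMap.toSpanSingleton (MvPolynomial X K) _ c).restrictScalars K
  have hT : ∀ p, T p = p • c := fun p => rfl
  have hTi : Function.Injective T := by
    intro p q h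
    have := congrFun h g
    rw [hT, hT] at this
    exact mul_right_cancel₀ hcg this
  have hle : (homogeneousSubmodule X K d).map T ≤ (W.restrictScalars K).map (pr K (d + j)) := by
    rintro _ ⟨p, hp, rfl⟩
    rw [HS.map_pr_mem _ (pr_pp K) W hW, hT]
    refine ⟨W.smul_mem _ hcW, ?_⟩
    funext g
    have h1 : (p • c) g ∈ homogeneousSubmodule X K (d + j) :=
      IsHomogeneous.mul hp (homogeneousComponent_isHomogeneous j (b g))
    rw [pr_apply, homogeneousComponent_of_mem h1, if_pos rfl]
  have := HS.fd_map (pr K) (pr_fd K) (W.restrictScalars K) (d + j)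
  have h2 := Submodule.finrank_mono hle
  rw [← (Submodule.equivMapOfInjective T hTi (homogeneousSubmodule X K d)).finrank_eq,
    finrank_hom] at h2
  unfold HS.hf
  exact_mod_cast h2

lemma lower2 (k : ℕ) (hk : Fintype.card X = k + 1)
    (W : Submodule (MvPolynomial X K) (Equiv.Perm X → MvPolynomial X K))
    (hW : HS.Hom (pr K) W) (hne : W ≠ ⊥) :
    ∃ N, ∀ d ≥ N, 1 ≤ HS.dl^[k] (HS.hf (pr K) W) d := by
  have hE := hilbertB K W hW
  rw [hk] at hE
  obtain ⟨e, N, hN⟩ := HS.ev_const k _ hE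
  obtain ⟨j, hj⟩ := lower K W hW hne
  refine ⟨N, fun d hd => ?_⟩
  rw [hN d hd]
  by_contra! he
  obtain ⟨N', hN'⟩ := HS.ev_neg k
    (fun d => HS.hf (pr K) W (d + j) - (((k+1).multichoose d : ℕ) : ℤ)) ⟨N, fun d hd => by
      rw [HS.dl_iter_sub k (fun d => HS.hf (pr K) W (d + j)), HS.dl_iter_shift]
      simp only
      rw [HS.dl_multichoose, hN _ (by omega)]
      omega⟩
  have h1 := hN' N' le_rfl
  have h2 := hj N'
  rw [hk] at h2
  omega

end polys
end Coc

namespace Coc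

section alg
variable {X M : Type*} [Fintype X] [Monoid M] (φ : M →* Equiv.Perm X) (π : M ≃ (X →₀ ℕ))
  (hπ : ∀ m n, π (m * n) = π m + (π n).mapDomain (φ m)) (K : Type*) [Field K]

include hπ in
lemma deg_mul (m n : M) : (π (m * n)).degree = (π m).degree + (π n).degree := by
  rw [hπ, map_add, Finsupp.degree_mapDomain]

include hπ in
lemma left_cancel (y m n : M) (h : y * m = y * n) : m = n := by
  have h1 := congrArg π h
  rw [hπ, hπ] at h1
  exact π.injective (Finsupp.mapDomain_injective (Equiv.injective _) (add_left_cancel h1))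

lemma Xi_mx (b : Equiv.Perm X → MvPolynomial X K) (x : X) (g : Equiv.Perm X) (y : M)
    (hy : π y = Finsupp.single (g⁻¹ x) 1) :
    Xi φ π hπ K (HS.mx (X := X) K _ x b) g =
      MonoidAlgebra.single y 1 * Xi φ π hπ K b (g * φ y) := by
  classical
  apply MonoidAlgebra.ext
  ext m
  rw [Xi_coeff]
  change MvPolynomial.coeff _ (MvPolynomial.X x * b (g * φ m)) = _
  rw [MvPolynomial.coeff_X_mul']
  have hyd : ∀ d, (π (y * d)).mapDomain g =
      Finsupp.single x 1 + (π d).mapDomain (g * φ y : Equiv.Perm X) := by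
    intro d
    rw [hπ, hy, Finsupp.mapDomain_add, Finsupp.mapDomain_single, mapDomain_mul]
    simp
  split_ifs with h
  · have hle : Finsupp.single (g⁻¹ x) 1 ≤ π m := by
      rw [Finsupp.single_le_iff]
      rw [Finsupp.mem_support_iff] at h
      have e : x = g (g⁻¹ x) := by simp
      rw [e, Finsupp.mapDomain_apply (Equiv.injective g)] at h
      omega
    set m' := π.symm ((π m - Finsupp.single (g⁻¹ x) 1).mapDomain ((φ y)⁻¹ : Equiv.Perm X)) with hm'
    have hm2 : π m' = (π m - Finsupp.single (g⁻¹ x) 1).mapDomain ((φ y)⁻¹ : Equiv.Perm X) :=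
      π.apply_symm_apply _
    have e : y * m' = m := by
      apply π.injective
      rw [hπ, hm2, mapDomain_self_inv, hy, add_tsub_cancel_of_le hle]
    clear_value m'
    subst e
    rw [MonoidAlgebra.coeff_single_mul_eq_mul_coeff m', one_mul, Xi_coeff, hyd, map_mul, mul_assoc,
      add_tsub_cancel_left]
    intro n _
    exact ⟨fun h => left_cancel φ π hπ y _ _ h, fun h => by rw [h]⟩
  · rw [MonoidAlgebra.coeff_single_mul_of_forall_mul_ne]
    rintro d rfl
    rw [hyd] at h
    simp at h

/-- degree component -/
noncomputable def cmp (d : ℕ) : MonoidAlgebra K M →ₗ[K] MonoidAlgebra K M :=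
  (MonoidAlgebra.coeffLinearEquiv K).symm.toLinearMap ∘ₗ
    (Finsupp.lsum K (fun m => if (π m).degree = d then Finsupp.lsingle m else 0) :
      (M →₀ K) →ₗ[K] (M →₀ K)) ∘ₗ
    (MonoidAlgebra.coeffLinearEquiv K).toLinearMap

lemma cmp_single (d : ℕ) (m : M) (r : K) : cmp π K d (MonoidAlgebra.single m r) =
    if (π m).degree = d then MonoidAlgebra.single m r else 0 := by
  have : (MonoidAlgebra.coeffLinearEquiv K) (MonoidAlgebra.single m r : MonoidAlgebra K M) =
    Finsupp.single m r := rfl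
  simp only [cmp, LinearMap.comp_apply, LinearEquiv.coe_coe, this]
  rw [Finsupp.lsum_single]
  split_ifs
  · rfl
  · simp

lemma cmp_coeff (d : ℕ) (s : MonoidAlgebra K M) (m : M) :
    (cmp π K d s).coeff m = if (π m).degree = d then s.coeff m else 0 := by
  classical
  induction s using MonoidAlgebra.induction_linear with
  | zero => simp
  | add x y hx hy =>
    rw [map_add, MonoidAlgebra.coeff_add, Finsupp.add_apply, hx, hy]
    split_ifs <;> simp
  | single n r =>
    rw [cmp_single]
    by_cases h : n = m
    · subst h; split_ifs <;> simp
    · split_ifs <;> simp [Finsupp.single_apply, h]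

lemma cmp_cmp (d : ℕ) (s : MonoidAlgebra K M) : cmp π K d (cmp π K d s) = cmp π K d s := by
  apply MonoidAlgebra.ext
  ext m
  rw [cmp_coeff, cmp_coeff]
  split_ifs <;> rfl

include hπ in
lemma cmp_mul (d j : ℕ) (s t : MonoidAlgebra K M) :
    cmp π K (d + j) (s * cmp π K j t) = cmp π K d s * cmp π K j t := by
  induction s using MonoidAlgebra.induction_linear with
  | zero => simp
  | add x y hx hy => rw [add_mul, map_add, hx, hy, map_add, add_mul]
  | single m r =>
    induction t using MonoidAlgebra.induction_linear with
    | zero => simp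
    | add x y hx hy => rw [map_add, mul_add, map_add, hx, hy, mul_add]
    | single n r' =>
      rw [cmp_single, cmp_single]
      by_cases h : (π n).degree = j
      · rw [if_pos h, MonoidAlgebra.single_mul_single, cmp_single, deg_mul φ π hπ, h]
        simp only [add_left_inj]
        split_ifs
        · rw [MonoidAlgebra.single_mul_single]
        · simp
      · rw [if_neg h]; simp

include hπ in
lemma cmp_mul_lt (e j : ℕ) (h : e < j) (s t : MonoidAlgebra K M) :
    cmp π K e (s * cmp π K j t) = 0 := by
  induction s using MonoidAlgebra.induction_linear with
  | zero => simp
  | add x y hx hy => rw [add_mul, map_add, hx, hy, add_zero]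
  | single m r =>
    induction t using MonoidAlgebra.induction_linear with
    | zero => simp
    | add x y hx hy => rw [map_add, mul_add, map_add, hx, hy, add_zero]
    | single n r' =>
      rw [cmp_single]
      by_cases h' : (π n).degree = j
      · rw [if_pos h', MonoidAlgebra.single_mul_single, cmp_single, deg_mul φ π hπ, if_neg]
        omega
      · rw [if_neg h']; simp

include hπ in
/-- left multiplication by a homogeneous single -/
lemma cmp_single_mul (e : ℕ) (m : M) (s : MonoidAlgebra K M) :
    cmp π K (e + (π m).degree) (MonoidAlgebra.single m 1 * s) =
      MonoidAlgebra.single m 1 * cmp π K e s := by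
  induction s using MonoidAlgebra.induction_linear with
  | zero => simp
  | add x y hx hy => rw [mul_add, map_add, hx, hy, map_add, mul_add]
  | single n r =>
    rw [MonoidAlgebra.single_mul_single, cmp_single, cmp_single, deg_mul φ π hπ]
    by_cases h : (π n).degree = e
    · rw [if_pos h, if_pos (by omega), MonoidAlgebra.single_mul_single]
    · rw [if_neg h, if_neg (by omega), mul_zero]

lemma Xi_pr (d : ℕ) (b : Equiv.Perm X → MvPolynomial X K) (g) :
    Xi φ π hπ K (pr K d b) g = cmp π K d (Xi φ π hπ K b g) := by
  apply MonoidAlgebra.ext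
  ext m
  rw [cmp_coeff, Xi_coeff, Xi_coeff, pr_apply, MvPolynomial.coeff_homogeneousComponent,
    Finsupp.degree_mapDomain]

/-- The `K`-subspace of `B` attached to `V`. -/
noncomputable def WV (V : Submodule K (MonoidAlgebra K M)) :
    Submodule K (Equiv.Perm X → MvPolynomial X K) :=
  (Submodule.pi Set.univ (fun _ => V)).comap (Xi φ π hπ K).toLinearMap

lemma mem_WV (V : Submodule K (MonoidAlgebra K M)) (b) :
    b ∈ WV φ π hπ K V ↔ ∀ g, Xi φ π hπ K b g ∈ V := by
  simp [WV]

lemma WV_mx (V : Submodule K (MonoidAlgebra K M))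
    (hl : ∀ m, ∀ s ∈ V, MonoidAlgebra.single m 1 * s ∈ V) (x : X) (b)
    (hb : b ∈ WV φ π hπ K V) : HS.mx (X := X) K _ x b ∈ WV φ π hπ K V := by
  rw [mem_WV] at hb ⊢
  intro g
  rw [Xi_mx φ π hπ K b x g (π.symm (Finsupp.single (g⁻¹ x) 1)) (π.apply_symm_apply _)]
  exact hl _ _ (hb _)

/-- The dimension function. -/
noncomputable def fv (V : Submodule K (MonoidAlgebra K M)) (d : ℕ) : ℤ :=
  (Module.finrank K (V.map (cmp π K d)) : ℤ)

include φ hπ in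
lemma finite_range_cmp (d : ℕ) : Module.Finite K (LinearMap.range (cmp π K d)) := by
  have := pr_fd (X := X) K d
  have h : LinearMap.range (cmp π K d) ≤ (LinearMap.range (pr (X := X) K d)).map
      (LinearMap.proj (1 : Equiv.Perm X) ∘ₗ (Xi φ π hπ K).toLinearMap) := by
    rintro _ ⟨s, rfl⟩
    refine ⟨pr K d ((Xi φ π hπ K).symm (fun _ => s)), ⟨_, rfl⟩, ?_⟩
    simp [Xi_pr]
  exact Submodule.finiteDimensional_of_le h

include φ hπ in
lemma finite_map_cmp (V : Submodule K (MonoidAlgebra K M)) (d : ℕ) :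
    Module.Finite K (V.map (cmp π K d)) := by
  have := finite_range_cmp φ π hπ K d
  exact Submodule.finiteDimensional_of_le (LinearMap.map_le_range)

lemma finrank_WV (V : Submodule K (MonoidAlgebra K M)) (d : ℕ) :
    Module.finrank K ((WV φ π hπ K V).map (pr K d)) =
      Nat.card (Equiv.Perm X) * Module.finrank K (V.map (cmp π K d)) := by
  classical
  have := finite_map_cmp φ π hπ K V d
  let Ψ : (Equiv.Perm X → V.map (cmp π K d)) →ₗ[K] (Equiv.Perm X → MvPolynomial X K) :=
    (Xi φ π hπ K).symm.toLinearMap ∘ₗ (V.map (cmp π K d)).subtype.compLeft (Equiv.Perm X)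
  have hΨ : ∀ v, Ψ v = (Xi φ π hπ K).symm (fun g => (v g : MonoidAlgebra K M)) := fun v => rfl
  have hinj : Function.Injective Ψ := by
    intro v w h
    rw [hΨ, hΨ] at h
    have h' := (Xi φ π hπ K).symm.injective h
    funext g
    exact Subtype.ext (congrFun h' g)
  have hr : (WV φ π hπ K V).map (pr K d) = LinearMap.range Ψ := by
    ext b
    constructor
    · rintro ⟨b, hb, rfl⟩
      have hb' := (mem_WV φ π hπ K V b).1 hb
      refine ⟨fun g => ⟨cmp π K d (Xi φ π hπ K b g), _, hb' g, rfl⟩, ?_⟩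
      rw [hΨ, LinearEquiv.symm_apply_eq]
      funext g
      rw [Xi_pr]
    · rintro ⟨v, rfl⟩
      choose s hs hs' using fun g => (v g).2
      refine ⟨(Xi φ π hπ K).symm s, ?_, ?_⟩
      · change _ ∈ WV φ π hπ K V
        rw [mem_WV]; intro g
        rw [LinearEquiv.apply_symm_apply]; exact hs g
      · rw [hΨ, LinearEquiv.eq_symm_apply]
        funext g
        rw [Xi_pr, LinearEquiv.apply_symm_apply]; exact hs' g
  rw [HS.fr_congr hr, LinearMap.finrank_range_of_inj hinj, Module.finrank_pi_fintype]
  simp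

include φ hπ in
lemma fv_top (d : ℕ) : fv π K ⊤ d = ((Fintype.card X).multichoose d : ℕ) := by
  have h := finrank_WV φ π hπ K ⊤ d
  have h2 : (WV φ π hπ K ⊤).map (pr K d) = LinearMap.range (pr (X := X) K d) := by
    have : WV φ π hπ K ⊤ = ⊤ := by
      ext b; simp [mem_WV]
    rw [this, Submodule.map_top]
  rw [HS.fr_congr h2, finrank_range_pr] at h
  have h3 := Nat.eq_of_mul_eq_mul_left Nat.card_pos h
  unfold fv
  rw [h3]

include φ hπ in
lemma fv_lower (k : ℕ) (hk : Fintype.card X = k + 1) (V : Submodule K (MonoidAlgebra K M))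
    (hl : ∀ m, ∀ s ∈ V, MonoidAlgebra.single m 1 * s ∈ V)
    (hc : ∀ d, ∀ s ∈ V, cmp π K d s ∈ V) (hne : V ≠ ⊥) :
    ∃ N, ∀ d ≥ N, 1 ≤ HS.dl^[k] (fv π K V) d := by
  let W := HS.mkSub (WV φ π hπ K V) (WV_mx φ π hπ K V hl)
  have hWm : ∀ b, b ∈ W ↔ ∀ g, Xi φ π hπ K b g ∈ V := mem_WV φ π hπ K V
  have hW : HS.Hom (pr K) W := by
    intro d b hb
    rw [hWm] at hb ⊢
    intro g
    rw [Xi_pr]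
    exact hc d _ (hb g)
  have hWne : W ≠ ⊥ := by
    obtain ⟨s, hs, hs0⟩ := V.ne_bot_iff.1 hne
    refine W.ne_bot_iff.2 ⟨(Xi φ π hπ K).symm (fun _ => s), ?_, ?_⟩
    · rw [hWm]; intro g; rw [LinearEquiv.apply_symm_apply]; exact hs
    · intro h
      rw [LinearEquiv.symm_apply_eq, map_zero] at h
      exact hs0 (congrFun h 1)
  have hf : HS.hf (pr K) W = fun d => (Nat.card (Equiv.Perm X) : ℤ) * fv π K V d := by
    funext d
    have := finrank_WV φ π hπ K V d
    unfold HS.hf fv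
    exact_mod_cast this
  obtain ⟨N, hN⟩ := lower2 K k hk W hW hWne
  refine ⟨N, fun d hd => ?_⟩
  have := hN d hd
  rw [hf, HS.dl_iter_mul] at this
  have hp : (0 : ℤ) < Nat.card (Equiv.Perm X) := by exact_mod_cast Nat.card_pos
  by_contra! h
  nlinarith

include φ hπ in
lemma hom_cancel (hX : 0 < Fintype.card X) (j : ℕ) (t : MonoidAlgebra K M)
    (h0 : cmp π K j t ≠ 0) (s : MonoidAlgebra K M) (hs : s * cmp π K j t = 0) : s = 0 := by
  obtain ⟨k, hk⟩ : ∃ k, Fintype.card X = k + 1 := ⟨_, (Nat.sub_add_cancel hX).symm⟩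
  by_contra hs0
  set a := cmp π K j t with ha
  let R : MonoidAlgebra K M →ₗ[K] MonoidAlgebra K M := LinearMap.mulRight K a
  have hR : ∀ s, R s = s * a := fun s => rfl
  let V1 := LinearMap.range R
  let V2 := LinearMap.ker R
  have h1 := fv_lower φ π hπ K k hk V1
    (by rintro m _ ⟨u, rfl⟩; exact ⟨MonoidAlgebra.single m 1 * u, by rw [hR, hR, mul_assoc]⟩)
    (by
      rintro d _ ⟨u, rfl⟩
      rcases lt_or_ge d j with h | h
      · rw [hR, ha, cmp_mul_lt φ π hπ K d j h]; exact V1.zero_mem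
      · obtain ⟨e, rfl⟩ := Nat.exists_eq_add_of_le' h
        rw [hR, ha, cmp_mul φ π hπ]
        exact ⟨_, hR _⟩)
    (V1.ne_bot_iff.2 ⟨a, ⟨1, by rw [hR, one_mul]⟩, h0⟩)
  have h2 := fv_lower φ π hπ K k hk V2
    (by intro m u hu
        have hu' : u * a = 0 := hu
        change MonoidAlgebra.single m 1 * u * a = 0
        rw [mul_assoc, hu', mul_zero])
    (by
      intro d u hu
      have hu' : u * a = 0 := hu
      change cmp π K d u * a = 0
      rw [ha, ← cmp_mul φ π hπ, ← ha, hu', map_zero])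
    (V2.ne_bot_iff.2 ⟨s, hs, hs0⟩)
  have key : ∀ d, fv π K V1 (d + j) + fv π K V2 d = ((k + 1).multichoose d : ℕ) := by
    intro d
    rw [← hk, ← fv_top φ π hπ K d]
    have hfin := finite_map_cmp φ π hπ K ⊤ d
    let T := R.domRestrict ((⊤ : Submodule K (MonoidAlgebra K M)).map (cmp π K d))
    have hT : ∀ u, T u = (u : MonoidAlgebra K M) * a := fun u => rfl
    have e0 := LinearMap.finrank_range_add_finrank_ker T
    have e1 : LinearMap.range T = V1.map (cmp π K (d + j)) := by
      ext u
      constructor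
      · rintro ⟨⟨_, u, _, rfl⟩, rfl⟩
        refine ⟨u * a, ⟨u, rfl⟩, ?_⟩
        rw [hT, ha, cmp_mul φ π hπ]
      · rintro ⟨_, ⟨u, rfl⟩, rfl⟩
        refine ⟨⟨cmp π K d u, u, trivial, rfl⟩, ?_⟩
        rw [hT, hR, ha, cmp_mul φ π hπ]
    have e2 : (LinearMap.ker T).map (Submodule.subtype _) = V2.map (cmp π K d) := by
      ext u
      constructor
      · rintro ⟨⟨_, u, _, rfl⟩, hu, rfl⟩
        refine ⟨cmp π K d u, hu, ?_⟩
        rw [cmp_cmp]; rfl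
      · rintro ⟨u, hu, rfl⟩
        refine ⟨⟨cmp π K d u, u, trivial, rfl⟩, ?_, rfl⟩
        have hu' : u * a = 0 := hu
        change cmp π K d u * a = 0
        rw [ha, ← cmp_mul φ π hπ, ← ha, hu', map_zero]
    have e3 : Module.finrank K (LinearMap.ker T) = Module.finrank K (V2.map (cmp π K d)) := by
      rw [← HS.fr_congr e2]
      exact (Submodule.equivMapOfInjective _ (Submodule.subtype_injective _) _).finrank_eq
    rw [HS.fr_congr e1, e3] at e0
    unfold fv
    exact_mod_cast e0
  obtain ⟨N1, h1⟩ := h1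
  obtain ⟨N2, h2⟩ := h2
  have k1 := h1 (N1 + N2 + j) (by omega)
  have k2 := h2 (N1 + N2) (by omega)
  have k3 := HS.dl_iter_add k (fun d => fv π K V1 (d + j)) (fv π K V2)
  rw [funext key, HS.dl_iter_shift] at k3
  have k4 := congrFun k3 (N1 + N2)
  rw [HS.dl_multichoose] at k4
  beta_reduce at k4
  omega

lemma cmp_zero_of_gt (s : MonoidAlgebra K M) : ∃ N, ∀ d ≥ N, cmp π K d s = 0 := by
  classical
  refine ⟨s.coeff.support.sup (fun m => (π m).degree) + 1, fun d hd => ?_⟩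
  apply MonoidAlgebra.ext
  ext m
  rw [cmp_coeff]
  split_ifs with h
  · by_contra hne
    have := Finset.le_sup (f := fun m => (π m).degree) (Finsupp.mem_support_iff.2 hne)
    omega
  · rfl

lemma exists_top (s : MonoidAlgebra K M) (hs : s ≠ 0) :
    ∃ p, cmp π K p s ≠ 0 ∧ ∀ d > p, cmp π K d s = 0 := by
  classical
  obtain ⟨N, hN⟩ := cmp_zero_of_gt π K s
  have hex : ∃ p, cmp π K p s ≠ 0 := by
    by_contra! h
    apply hs
    apply MonoidAlgebra.ext
    ext m
    have := congrArg (fun u => u.coeff m) (h (π m).degree)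
    simp only [cmp_coeff, if_true] at this
    simpa using this
  obtain ⟨p, hp⟩ := hex
  have hpN : p ≤ N := by
    by_contra! h; exact hp (hN p h.le)
  have hP := Nat.findGreatest_spec (P := fun p => cmp π K p s ≠ 0) hpN hp
  refine ⟨_, hP, fun d hd => ?_⟩
  by_contra hne
  rcases le_or_gt d N with h | h
  · exact Nat.findGreatest_is_greatest hd h hne
  · exact hne (hN d h.le)

lemma eq_sum_cmp (s : MonoidAlgebra K M) (p : ℕ) (h : ∀ d > p, cmp π K d s = 0) :
    s = ∑ d ∈ Finset.range (p + 1), cmp π K d s := by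
  classical
  apply MonoidAlgebra.ext
  ext m
  have e : (∑ d ∈ Finset.range (p + 1), cmp π K d s).coeff m =
      ∑ d ∈ Finset.range (p + 1), (cmp π K d s).coeff m := by
    simp [MonoidAlgebra.coeff_sum, Finsupp.finsetSum_apply]
  rw [e]
  simp only [cmp_coeff]
  rw [Finset.sum_ite_eq]
  split_ifs with h1
  · rfl
  · have := congrArg (fun u => u.coeff m) (h (π m).degree (by simpa using h1))
    simpa [cmp_coeff] using this

include φ hπ in
theorem noZeroDiv : ∀ s t : MonoidAlgebra K M, s * t = 0 → s = 0 ∨ t = 0 := by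
  rcases Nat.eq_zero_or_pos (Fintype.card X) with h0 | hX
  · have hXe : IsEmpty X := Fintype.card_eq_zero_iff.1 h0
    have : Subsingleton M := π.injective.subsingleton
    intro s t hst
    have h1 : ∀ u : MonoidAlgebra K M, u = MonoidAlgebra.single 1 (u.coeff 1) := by
      intro u
      apply MonoidAlgebra.ext
      ext m
      rw [Subsingleton.elim m 1]; simp
    rw [h1 s, h1 t, MonoidAlgebra.single_mul_single] at hst
    have h2 := congrArg (fun u => u.coeff 1) hst
    simp at h2
    rcases h2 with h | h
    · left; rw [h1 s, h]; simp
    · right; rw [h1 t, h]; simp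
  intro s t hst
  by_contra! hne
  obtain ⟨p, hp, hp'⟩ := exists_top π K s hne.1
  obtain ⟨q, hq, hq'⟩ := exists_top π K t hne.2
  apply hp
  apply hom_cancel φ π hπ K hX q t hq
  have e : cmp π K (p + q) (s * t) = cmp π K p s * cmp π K q t := by
    conv_lhs => rw [eq_sum_cmp π K t q hq']
    rw [Finset.mul_sum, map_sum, Finset.sum_eq_single q, cmp_mul φ π hπ]
    · intro d hd hdq
      have hlt : d < q := by have := Finset.mem_range.1 hd; omega
      obtain ⟨e, he⟩ : ∃ e, p + q = e + d := ⟨p + q - d, by omega⟩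
      rw [he, cmp_mul φ π hπ, hp' e (by omega), zero_mul]
    · intro h; simp at h
  rw [← e, hst, map_zero]

end alg
end Coc

namespace Sol

section gen
variable {X : Type*} (lam : X → Equiv.Perm X) (rho : X → X → X)

lemma ind {P : StructureMonoid lam rho → Prop} (h1 : P 1)
    (hc : ∀ x m, P m → P (ofM lam rho x * m)) (m : StructureMonoid lam rho) : P m := by
  induction m using Con.induction_on with
  | H w =>
    induction w using FreeMonoid.recOn with
    | one => exact h1
    | of_mul x w hw => exact hc x _ hw

lemma rel (x y : X) : ofM lam rho x * ofM lam rho y =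
    ofM lam rho (lam x y) * ofM lam rho (rho y x) := by
  apply (Con.eq _).2
  exact ConGen.Rel.of _ _ ⟨x, y, rfl, rfl⟩

/-- Universal property of the structure monoid. -/
def liftM {N : Type*} [Monoid N] (f : X → N)
    (hf : ∀ x y, f x * f y = f (lam x y) * f (rho y x)) : StructureMonoid lam rho →* N :=
  Con.lift _ (FreeMonoid.lift f) (by
    rw [Con.conGen_le]
    rintro _ _ ⟨x, y, rfl, rfl⟩
    simpa using hf x y)

lemma liftM_of {N : Type*} [Monoid N] (f : X → N)
    (hf : ∀ x y, f x * f y = f (lam x y) * f (rho y x)) (x : X) :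
    liftM lam rho f hf (ofM lam rho x) = f x := by
  simp [liftM, ofM]

variable (hYB1 : ∀ x y z : X, lam x (lam y z) = lam (lam x y) (lam (rho y x) z))

/-- The action of the structure monoid. -/
def phi : StructureMonoid lam rho →* Equiv.Perm X :=
  liftM lam rho lam (fun x y => Equiv.ext (fun z => hYB1 x y z))

lemma phi_of (x : X) : phi lam rho hYB1 (ofM lam rho x) = lam x := liftM_of _ _ _ _ x

section inv
variable (hinv : ∀ x y, lam (lam x y) (rho y x) = x)

/-- The affine action in the involutive case. -/
noncomputable def act : StructureMonoid lam rho →* Function.End (X →₀ ℕ) :=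
  liftM lam rho (fun x => (fun s => Finsupp.single x 1 + s.mapDomain (lam x))) (by
    intro x y
    funext s
    change Finsupp.single x 1 + (Finsupp.single y 1 + s.mapDomain (lam y)).mapDomain (lam x) =
      Finsupp.single (lam x y) 1 + (Finsupp.single (rho y x) 1 +
        s.mapDomain (lam (rho y x))).mapDomain (lam (lam x y))
    rw [Finsupp.mapDomain_add, Finsupp.mapDomain_add, Finsupp.mapDomain_single,
      Finsupp.mapDomain_single, hinv, ← Finsupp.mapDomain_comp, ← Finsupp.mapDomain_comp,
      add_left_comm]
    congr 3
    funext z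
    exact hYB1 x y z)

/-- The cocycle in the involutive case. -/
noncomputable def pi0 (m : StructureMonoid lam rho) : X →₀ ℕ := act lam rho hYB1 hinv m 0

lemma act_of_mul (x : X) (m : StructureMonoid lam rho) (s : X →₀ ℕ) :
    act lam rho hYB1 hinv (ofM lam rho x * m) s =
      Finsupp.single x 1 + (act lam rho hYB1 hinv m s).mapDomain (lam x) := by
  rw [map_mul]
  have : act lam rho hYB1 hinv (ofM lam rho x) =
    (fun s => Finsupp.single x 1 + s.mapDomain (lam x)) := liftM_of _ _ _ _ x
  rw [this]; rfl

lemma pi0_one : pi0 lam rho hYB1 hinv 1 = 0 := by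
  unfold pi0; rw [map_one]; rfl

lemma pi0_of_mul (x : X) (m : StructureMonoid lam rho) :
    pi0 lam rho hYB1 hinv (ofM lam rho x * m) =
      Finsupp.single x 1 + (pi0 lam rho hYB1 hinv m).mapDomain (lam x) :=
  act_of_mul lam rho hYB1 hinv x m 0

lemma pi0_mul (m n : StructureMonoid lam rho) : pi0 lam rho hYB1 hinv (m * n) =
    pi0 lam rho hYB1 hinv m + (pi0 lam rho hYB1 hinv n).mapDomain (phi lam rho hYB1 m) := by
  induction m using ind with
  | h1 => rw [one_mul, pi0_one, map_one, zero_add]; exact Finsupp.mapDomain_id.symm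
  | hc x m ih =>
    rw [mul_assoc, pi0_of_mul, ih, pi0_of_mul, Finsupp.mapDomain_add, map_mul, phi_of, add_assoc,
      ← Finsupp.mapDomain_comp]
    rfl

lemma occ (m : StructureMonoid lam rho) : ∀ x, pi0 lam rho hYB1 hinv m x ≠ 0 →
    ∃ m1, m = ofM lam rho x * m1 := by
  classical
  induction m using ind with
  | h1 => intro x h; rw [pi0_one] at h; simp at h
  | hc y m ih =>
    intro x h
    by_cases hxy : y = x
    · exact ⟨m, by rw [hxy]⟩
    rw [pi0_of_mul] at h
    have e : x = lam y ((lam y).symm x) := by simp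
    rw [Finsupp.add_apply, Finsupp.single_apply, if_neg hxy, zero_add, e,
      Finsupp.mapDomain_apply (lam y).injective] at h
    obtain ⟨m2, rfl⟩ := ih _ h
    refine ⟨ofM lam rho (rho ((lam y).symm x) y) * m2, ?_⟩
    rw [← mul_assoc, rel, ← mul_assoc]
    simp

lemma pi0_inj : Function.Injective (pi0 lam rho hYB1 hinv) := by
  intro m
  induction m using ind with
  | h1 =>
    intro n
    induction n using ind with
    | h1 => intro _; rfl
    | hc y n _ =>
      intro h
      rw [pi0_one, pi0_of_mul] at h
      have := DFunLike.congr_fun h y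
      simp at this
      omega
  | hc x m ih =>
    intro n h
    have hx : pi0 lam rho hYB1 hinv n x ≠ 0 := by
      rw [← h, pi0_of_mul]; simp
    obtain ⟨n1, rfl⟩ := occ lam rho hYB1 hinv n x hx
    rw [pi0_of_mul, pi0_of_mul] at h
    rw [ih (Finsupp.mapDomain_injective (lam x).injective (add_left_cancel h))]

lemma pi0_surj : Function.Surjective (pi0 lam rho hYB1 hinv) := by
  have key : ∀ d : ℕ, ∀ a : X →₀ ℕ, a.degree = d → ∃ m, pi0 lam rho hYB1 hinv m = a := by
    intro d
    induction d with
    | zero =>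
      intro a ha
      rw [Finsupp.degree_eq_zero_iff] at ha
      exact ⟨1, by rw [pi0_one, ha]⟩
    | succ d ih =>
      intro a ha
      have hne : a ≠ 0 := by rintro rfl; simp at ha
      obtain ⟨x, hx⟩ := Finsupp.ne_iff.1 hne
      have hle : Finsupp.single x 1 ≤ a := by
        rw [Finsupp.single_le_iff]
        simp at hx; omega
      have e := add_tsub_cancel_of_le hle
      have hd : (a - Finsupp.single x 1).degree = d := by
        have := congrArg Finsupp.degree e
        rw [map_add, Finsupp.degree_single] at this
        omega
      obtain ⟨m, hm⟩ := ih ((a - Finsupp.single x 1).mapDomain (lam x).symm)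
        (by rw [Finsupp.degree_mapDomain, hd])
      refine ⟨ofM lam rho x * m, ?_⟩
      rw [pi0_of_mul, hm, ← Finsupp.mapDomain_comp]
      have : (lam x : X → X) ∘ (lam x).symm = id := by funext z; simp
      rw [this, Finsupp.mapDomain_id, e]
  exact fun a => key _ a rfl

end inv

/-! The general case. -/

/-- The operators `R_x`. -/
def R (x : X) : Function.End (StructureMonoid lam rho) :=
  fun m => m * ofM lam rho ((phi lam rho hYB1 m)⁻¹ x)

/-- Left multiplications. -/
def L (m : StructureMonoid lam rho) : Function.End (StructureMonoid lam rho) := fun n => m * n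

variable (hYB2 : ∀ x y z : X,
      lam (rho (lam y z) x) (rho z y) = rho (lam (rho y x) z) (lam x y))
  (hbij : Function.Bijective (fun p : X × X => (lam p.1 p.2, rho p.2 p.1)))

include hYB1 hYB2 in
lemma equiv1 (a z x : X) :
    lam a (sigmaMap lam rho z x) = sigmaMap lam rho (lam a z) (lam a x) := by
  obtain ⟨y, rfl⟩ := (lam x).surjective z
  unfold sigmaMap
  rw [Equiv.symm_apply_apply, hYB1, hYB2]
  congr 2
  rw [Equiv.eq_symm_apply, ← hYB1]

include hYB2 in
lemma equiv2 (m : StructureMonoid lam rho) (z x : X) :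
    phi lam rho hYB1 m (sigmaMap lam rho z x) =
      sigmaMap lam rho (phi lam rho hYB1 m z) (phi lam rho hYB1 m x) := by
  induction m using ind with
  | h1 => simp
  | hc a m ih =>
    rw [map_mul, Equiv.Perm.mul_apply, Equiv.Perm.mul_apply, Equiv.Perm.mul_apply, ih, phi_of,
      equiv1 lam rho hYB1 hYB2]

include hYB2 in
lemma equiv3 (m : StructureMonoid lam rho) (z x : X) :
    (phi lam rho hYB1 m)⁻¹ (sigmaMap lam rho z x) =
      sigmaMap lam rho ((phi lam rho hYB1 m)⁻¹ z) ((phi lam rho hYB1 m)⁻¹ x) := by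
  rw [Equiv.Perm.inv_eq_iff_eq, equiv2 lam rho hYB1 hYB2]
  simp

include hYB2 in
lemma R_semi (z x : X) : SemiconjBy (R lam rho hYB1 z) (R lam rho hYB1 x)
    (R lam rho hYB1 (sigmaMap lam rho z x)) := by
  funext m
  change m * _ * ofM lam rho ((phi lam rho hYB1 (m * _))⁻¹ z) =
    m * _ * ofM lam rho ((phi lam rho hYB1 (m * _))⁻¹ (sigmaMap lam rho z x))
  rw [map_mul, map_mul, phi_of, phi_of, mul_inv_rev, mul_inv_rev, Equiv.Perm.mul_apply,
    Equiv.Perm.mul_apply, equiv3 lam rho hYB1 hYB2]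
  set u := (phi lam rho hYB1 m)⁻¹ x
  set v := (phi lam rho hYB1 m)⁻¹ z
  rw [mul_assoc, mul_assoc, rel]
  congr 2
  · simp
  · unfold sigmaMap
    simp [Equiv.Perm.inv_def]

lemma L_semi (m : StructureMonoid lam rho) (x : X) : SemiconjBy (L lam rho m) (R lam rho hYB1 x)
    (R lam rho hYB1 (phi lam rho hYB1 m x)) := by
  funext n
  change m * (n * ofM lam rho ((phi lam rho hYB1 n)⁻¹ x)) =
    m * n * ofM lam rho ((phi lam rho hYB1 (m * n))⁻¹ (phi lam rho hYB1 m x))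
  rw [map_mul, mul_inv_rev, Equiv.Perm.mul_apply, mul_assoc]
  simp

include hbij in
lemma sigma_inj (z : X) : Function.Injective (sigmaMap lam rho z) := by
  intro x x' h
  have h' := (lam z).injective h
  have := @hbij.1 (x, (lam x).symm z) (x', (lam x').symm z) (by simp [h'])
  exact congrArg Prod.fst this

variable [Fintype X]

/-- `σ_z` as a permutation. -/
noncomputable def sg (z : X) : Equiv.Perm X :=
  Equiv.ofBijective (sigmaMap lam rho z) (Finite.injective_iff_bijective.1
    (sigma_inj lam rho hbij z))

variable (X) in
/-- The exponent used. -/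
noncomputable def dd : ℕ := Nat.card (Equiv.Perm X)

lemma dd_pos : 0 < dd X := Nat.card_pos

lemma pow_dd (g : Equiv.Perm X) : g ^ dd X = 1 := by
  have h := pow_card_eq_one' (x := g)
  exact h

/-- `R_x^d`. -/
noncomputable def Pw (x : X) : Function.End (StructureMonoid lam rho) := R lam rho hYB1 x ^ dd X

include hYB2 hbij in
lemma Pw_comm_R (z x : X) : Commute (Pw lam rho hYB1 z) (R lam rho hYB1 x) := by
  have key : ∀ k : ℕ, SemiconjBy (R lam rho hYB1 z ^ k) (R lam rho hYB1 x)
      (R lam rho hYB1 ((sg lam rho hbij z ^ k) x)) := by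
    intro k
    induction k with
    | zero => simp
    | succ k ih =>
      rw [pow_succ', pow_succ', Equiv.Perm.mul_apply]
      exact (R_semi lam rho hYB1 hYB2 z _).mul_left ih
  have := key (dd X)
  rw [pow_dd] at this
  exact this

include hYB2 hbij in
lemma Pw_comm (z x : X) : Commute (Pw lam rho hYB1 z) (Pw lam rho hYB1 x) :=
  (Pw_comm_R lam rho hYB1 hYB2 hbij z x).pow_right _

/-- The product of all `R_x^d`. -/
noncomputable def Q : Function.End (StructureMonoid lam rho) :=
  ((Finset.univ : Finset X).toList.map (Pw lam rho hYB1)).prod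

include hYB2 hbij in
lemma Q_comm_R (x : X) : Commute (Q lam rho hYB1) (R lam rho hYB1 x) := by
  unfold Q
  apply Commute.list_prod_left
  intro p hp
  obtain ⟨z, _, rfl⟩ := List.mem_map.1 hp
  exact Pw_comm_R lam rho hYB1 hYB2 hbij z x

lemma semi_list (f : Function.End (StructureMonoid lam rho)) (τ : X → X)
    (h : ∀ x, SemiconjBy f (Pw lam rho hYB1 x) (Pw lam rho hYB1 (τ x))) (l : List X) :
    SemiconjBy f (l.map (Pw lam rho hYB1)).prod ((l.map τ).map (Pw lam rho hYB1)).prod := by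
  induction l with
  | nil => simp
  | cons x l ih =>
    simp only [List.map_cons, List.prod_cons]
    exact (h x).mul_right ih

include hYB2 hbij in
lemma Q_comm_L (m : StructureMonoid lam rho) : Commute (L lam rho m) (Q lam rho hYB1) := by
  have h := semi_list lam rho hYB1 (L lam rho m) (phi lam rho hYB1 m)
    (fun x => (L_semi lam rho hYB1 m x).pow_right _) (Finset.univ : Finset X).toList
  have hp : List.Perm ((Finset.univ : Finset X).toList.map (phi lam rho hYB1 m))
      (Finset.univ : Finset X).toList := by
    rw [List.perm_ext_iff_of_nodup ((Finset.nodup_toList _).map (Equiv.injective _))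
      (Finset.nodup_toList _)]
    intro a
    simp only [List.mem_map, Finset.mem_toList, Finset.mem_univ, true_and, iff_true]
    exact ⟨_, (phi lam rho hYB1 m).apply_symm_apply a⟩
  have e : (((Finset.univ : Finset X).toList.map (phi lam rho hYB1 m)).map
      (Pw lam rho hYB1)).prod = Q lam rho hYB1 := by
    apply List.Perm.prod_eq' (hp.map _)
    apply List.Pairwise.imp_of_mem (R := fun _ _ => True) _
      (List.pairwise_of_forall (fun _ _ => trivial))
    intro a b ha hb _
    obtain ⟨x, _, rfl⟩ := List.mem_map.1 ha
    obtain ⟨y, _, rfl⟩ := List.mem_map.1 hb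
    exact Pw_comm lam rho hYB1 hYB2 hbij x y
  rw [e] at h
  exact h

include hYB2 hbij in
lemma Q_apply (m : StructureMonoid lam rho) :
    Q lam rho hYB1 m = m * Q lam rho hYB1 1 := by
  have := congrFun (Q_comm_L lam rho hYB1 hYB2 hbij m) 1
  change m * Q lam rho hYB1 1 = Q lam rho hYB1 (m * 1) at this
  rw [mul_one] at this
  exact this.symm

include hYB2 hbij in
lemma Q_pow_apply (e : ℕ) (m : StructureMonoid lam rho) :
    (Q lam rho hYB1 ^ e) m = m * (Q lam rho hYB1 1) ^ e := by
  induction e with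
  | zero => rw [pow_zero, pow_zero, mul_one]; rfl
  | succ e ih =>
    rw [pow_succ', pow_succ]
    change Q lam rho hYB1 ((Q lam rho hYB1 ^ e) m) = _
    rw [ih, Q_apply lam rho hYB1 hYB2 hbij, mul_assoc]

/-- The central element. -/
noncomputable def ww : StructureMonoid lam rho := (Q lam rho hYB1 1) ^ dd X

include hYB2 hbij in
lemma ww_central (m : StructureMonoid lam rho) : ww lam rho hYB1 * m = m * ww lam rho hYB1 := by
  induction m using ind with
  | h1 => simp
  | hc x m ih =>
    have h := congrFun ((Q_comm_R lam rho hYB1 hYB2 hbij x).pow_left (dd X)) 1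
    change (Q lam rho hYB1 ^ dd X) (R lam rho hYB1 x 1) =
      R lam rho hYB1 x ((Q lam rho hYB1 ^ dd X) 1) at h
    rw [Q_pow_apply lam rho hYB1 hYB2 hbij, Q_pow_apply lam rho hYB1 hYB2 hbij] at h
    have hw : phi lam rho hYB1 (ww lam rho hYB1) = 1 := by
      rw [ww, map_pow, pow_dd]
    have h2 : ofM lam rho x * ww lam rho hYB1 = ww lam rho hYB1 * ofM lam rho x := by
      change (1 * ofM lam rho ((phi lam rho hYB1 1)⁻¹ x)) * ww lam rho hYB1 =
        (1 * ww lam rho hYB1) *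
          ofM lam rho ((phi lam rho hYB1 (1 * ww lam rho hYB1))⁻¹ x) at h
      rw [one_mul, one_mul, map_one, hw] at h
      simpa using h
    rw [← mul_assoc, ← h2, mul_assoc, ih, mul_assoc]

include hYB2 hbij in
lemma Q_eq_of_R (x : X) (m n : StructureMonoid lam rho)
    (h : R lam rho hYB1 x m = R lam rho hYB1 x n) :
    Q lam rho hYB1 m = Q lam rho hYB1 n := by
  have hP : Pw lam rho hYB1 x m = Pw lam rho hYB1 x n := by
    unfold Pw
    obtain ⟨k, hk⟩ : ∃ k, dd X = k + 1 := ⟨_, (Nat.sub_add_cancel dd_pos).symm⟩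
    rw [hk, pow_succ]
    change (R lam rho hYB1 x ^ k) (R lam rho hYB1 x m) = (R lam rho hYB1 x ^ k) (R lam rho hYB1 x n)
    rw [h]
  have key : ∀ l : List X, x ∈ l →
      (l.map (Pw lam rho hYB1)).prod m = (l.map (Pw lam rho hYB1)).prod n := by
    intro l
    induction l with
    | nil => simp
    | cons y l ih =>
      intro hx
      rw [List.map_cons, List.prod_cons]
      by_cases hxy : x = y
      · subst hxy
        have hc : Commute (Pw lam rho hYB1 x) (l.map (Pw lam rho hYB1)).prod := by
          apply Commute.list_prod_right
          intro p hp
          obtain ⟨z, _, rfl⟩ := List.mem_map.1 hp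
          exact Pw_comm lam rho hYB1 hYB2 hbij x z
        rw [hc.eq]
        change (l.map (Pw lam rho hYB1)).prod (Pw lam rho hYB1 x m) =
          (l.map (Pw lam rho hYB1)).prod (Pw lam rho hYB1 x n)
        rw [hP]
      · have := ih (by simpa [hxy] using hx)
        change Pw lam rho hYB1 y ((l.map (Pw lam rho hYB1)).prod m) =
          Pw lam rho hYB1 y ((l.map (Pw lam rho hYB1)).prod n)
        rw [this]
  exact key _ (by simp)

end gen

section words
variable {X : Type*} (lam : X → Equiv.Perm X) (rho : X → X → X)
  (hbij : Function.Bijective (fun p : X × X => (lam p.1 p.2, rho p.2 p.1)))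

/-- `r`-fixed pairs -/
def Fx (a b : X) : Prop := lam a b = a ∧ rho b a = b

/-- words all of whose adjacent pairs are fixed -/
def PW (w : FreeMonoid X) : Prop := List.IsChain (Fx lam rho) (FreeMonoid.toList w)

lemma PW_left (v w : FreeMonoid X) (h : PW lam rho (v * w)) : PW lam rho v := by
  unfold PW at *
  rw [FreeMonoid.toList_mul, List.isChain_append] at h
  exact h.1

lemma PW_right (v w : FreeMonoid X) (h : PW lam rho (v * w)) : PW lam rho w := by
  unfold PW at *
  rw [FreeMonoid.toList_mul, List.isChain_append] at h
  exact h.2.1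

/-- The congruence with singleton classes on rigid words. -/
def rigid : Con (FreeMonoid X) where
  r v w := v = w ∨ (¬ PW lam rho v ∧ ¬ PW lam rho w)
  iseqv := by
    refine ⟨fun _ => Or.inl rfl, ?_, ?_⟩
    · rintro v w (h | h)
      · exact Or.inl h.symm
      · exact Or.inr ⟨h.2, h.1⟩
    · rintro u v w (h | h) (h' | h')
      · exact Or.inl (h.trans h')
      · subst h; exact Or.inr h'
      · subst h'; exact Or.inr h
      · exact Or.inr ⟨h.1, h'.2⟩
  mul' := by
    rintro u v w z (h | h) (h' | h')
    · left; rw [h, h']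
    · exact Or.inr ⟨fun k => h'.1 (PW_right _ _ _ _ k), fun k => h'.2 (PW_right _ _ _ _ k)⟩
    · exact Or.inr ⟨fun k => h.1 (PW_left _ _ _ _ k), fun k => h.2 (PW_left _ _ _ _ k)⟩
    · exact Or.inr ⟨fun k => h.1 (PW_left _ _ _ _ k), fun k => h.2 (PW_left _ _ _ _ k)⟩

include hbij in
lemma rigid_le : conGen (structureRel lam rho) ≤ rigid lam rho := by
  rw [Con.conGen_le]
  rintro _ _ ⟨x, y, rfl, rfl⟩
  have hP : ∀ a b : X, PW lam rho (FreeMonoid.of a * FreeMonoid.of b) ↔ Fx lam rho a b := by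
    intro a b
    unfold PW
    simp [FreeMonoid.toList_mul]
  change _ ∨ _
  by_cases h : Fx lam rho x y
  · left; rw [h.1, h.2]
  · right
    rw [hP, hP]
    refine ⟨h, fun h' => h ?_⟩
    have := @hbij.1 (lam x y, rho y x) (x, y) (Prod.ext h'.1 h'.2)
    simp only [Prod.mk.injEq] at this
    exact this

include hbij in
lemma mk_inj (v w : FreeMonoid X) (hv : PW lam rho v)
    (h : (conGen (structureRel lam rho)).mk' v = (conGen (structureRel lam rho)).mk' w) :
    v = w := by
  have h1 := rigid_le lam rho hbij ((Con.eq _).1 h)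
  rcases h1 with h1 | h1
  · exact h1
  · exact absurd hv h1.1

include hbij in
lemma ofM_inj : Function.Injective (ofM lam rho) := by
  intro x y h
  have := mk_inj lam rho hbij _ _ (by unfold PW; simp) h
  exact FreeMonoid.of_injective this

/-- The words of `R_u^k(1)`. -/
def wd : X → ℕ → FreeMonoid X
  | _, 0 => 1
  | u, k + 1 => FreeMonoid.of u * wd ((lam u).symm u) k

lemma wd_PW (hs : ∀ v, sigmaMap lam rho v v = v) (k : ℕ) : ∀ u, PW lam rho (wd lam u k) := by
  induction k with
  | zero => intro u; unfold PW wd; simp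
  | succ k ih =>
    intro u
    have h1 := ih ((lam u).symm u)
    cases k with
    | zero => unfold PW wd wd; simp
    | succ k =>
      unfold PW at *
      unfold wd
      unfold wd at *
      simp only [FreeMonoid.toList_mul, FreeMonoid.toList_of, List.singleton_append] at *
      rw [List.isChain_cons_cons]
      refine ⟨⟨by simp, ?_⟩, h1⟩
      rw [Equiv.eq_symm_apply]
      exact hs u

lemma wd_R (hYB1 : ∀ x y z : X, lam x (lam y z) = lam (lam x y) (lam (rho y x) z)) (k : ℕ) :
    ∀ u, (R lam rho hYB1 u ^ k) 1 = (conGen (structureRel lam rho)).mk' (wd lam u k) := by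
  induction k with
  | zero => intro u; rfl
  | succ k ih =>
    intro u
    unfold wd
    rw [map_mul, ← ih, pow_succ]
    have h := congrFun ((L_semi lam rho hYB1 (ofM lam rho u) ((lam u).symm u)).pow_right k) 1
    rw [phi_of, Equiv.apply_symm_apply] at h
    change (R lam rho hYB1 u ^ k) (1 * ofM lam rho ((phi lam rho hYB1 1)⁻¹ u)) = _
    change ofM lam rho u * (R lam rho hYB1 ((lam u).symm u) ^ k) 1 =
      (R lam rho hYB1 u ^ k) (ofM lam rho u * 1) at h
    rw [one_mul, map_one, inv_one, Equiv.Perm.one_apply]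
    rw [mul_one] at h
    exact h.symm

variable [Fintype X]
    (hYB1 : ∀ x y z : X, lam x (lam y z) = lam (lam x y) (lam (rho y x) z))
    (hYB2 : ∀ x y z : X,
      lam (rho (lam y z) x) (rho z y) = rho (lam (rho y x) z) (lam x y))

include hYB1 hYB2 hbij in
theorem involutive_of (hC : ∀ m n w : StructureMonoid lam rho, (∀ u, w * u = u * w) →
    m * w = n * w → m = n) (p : X × X) :
    (fun q : X × X => (lam q.1 q.2, rho q.2 q.1))
          ((fun q : X × X => (lam q.1 q.2, rho q.2 q.1)) p) = p := by
  have hR : ∀ x, Function.Injective (R lam rho hYB1 x) := by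
    intro x m n h
    have h1 := Q_eq_of_R lam rho hYB1 hYB2 hbij x m n h
    rw [Q_apply lam rho hYB1 hYB2 hbij, Q_apply lam rho hYB1 hYB2 hbij n] at h1
    apply hC m n (ww lam rho hYB1) (ww_central lam rho hYB1 hYB2 hbij)
    obtain ⟨k, hk⟩ : ∃ k, dd X = k + 1 := ⟨_, (Nat.sub_add_cancel dd_pos).symm⟩
    rw [ww, hk, pow_succ', ← mul_assoc, h1, mul_assoc]
  have R1 : ∀ x, R lam rho hYB1 x 1 = ofM lam rho x := by
    intro x
    change 1 * ofM lam rho ((phi lam rho hYB1 1)⁻¹ x) = _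
    simp
  have hs : ∀ v, sigmaMap lam rho v v = v := by
    intro z
    obtain ⟨x, hx⟩ := (sg lam rho hbij z).surjective z
    change sigmaMap lam rho z x = z at hx
    have h := congrFun (R_semi lam rho hYB1 hYB2 z x) 1
    rw [hx] at h
    have h2 : R lam rho hYB1 x 1 = R lam rho hYB1 z 1 := hR z h
    rw [R1, R1] at h2
    have h3 := ofM_inj lam rho hbij h2
    rw [h3] at hx
    exact hx
  have hs2 : ∀ x y, sigmaMap lam rho x y = y := by
    intro x y
    have h1 : SemiconjBy (R lam rho hYB1 x) (Pw lam rho hYB1 y)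
        (Pw lam rho hYB1 (sigmaMap lam rho x y)) := (R_semi lam rho hYB1 hYB2 x y).pow_right _
    have h2 := Pw_comm_R lam rho hYB1 hYB2 hbij (sigmaMap lam rho x y) x
    have h3 := congrFun (h1.eq.trans h2.eq) 1
    have h4 := hR x h3
    unfold Pw at h4
    rw [wd_R, wd_R] at h4
    have h5 := mk_inj lam rho hbij _ _ (wd_PW lam rho hs _ _) h4
    obtain ⟨k, hk⟩ : ∃ k, dd X = k + 1 := ⟨_, (Nat.sub_add_cancel dd_pos).symm⟩
    rw [hk] at h5
    unfold wd at h5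
    have h6 := congrArg FreeMonoid.toList h5
    simp only [FreeMonoid.toList_mul, FreeMonoid.toList_of, List.singleton_append,
      List.cons.injEq] at h6
    exact h6.1.symm
  have hinv : ∀ x y, lam (lam x y) (rho y x) = x := by
    intro x y
    have := hs2 (lam x y) x
    unfold sigmaMap at this
    rwa [Equiv.symm_apply_apply] at this
  obtain ⟨x, y⟩ := p
  refine Prod.ext (hinv x y) ?_
  have h1 := hinv (lam x y) (rho y x)
  rw [hinv x y] at h1
  exact (lam x).injective h1

end words

section der
variable {X : Type*} (lam : X → Equiv.Perm X) (rho : X → X → X)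
  (hinv : ∀ x y, lam (lam x y) (rho y x) = x)

include hinv in
lemma sigma_id (z x : X) : sigmaMap lam rho z x = x := by
  obtain ⟨y, rfl⟩ := (lam x).surjective z
  unfold sigmaMap
  rw [Equiv.symm_apply_apply, hinv]

/-- The multiset of letters. -/
def toMs : DerivedMonoid lam rho →* Multiplicative (Multiset X) :=
  Con.lift _ (FreeMonoid.lift (fun x => Multiplicative.ofAdd {x})) (by
    rw [Con.conGen_le]
    rintro _ _ ⟨x, y, rfl, rfl⟩
    rw [Con.ker_rel]
    simp only [map_mul, FreeMonoid.lift_eval_of]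
    rw [sigma_id lam rho hinv, mul_comm])

lemma toMs_mk (w : FreeMonoid X) : toMs lam rho hinv ((conGen (derivedRel lam rho)).mk' w) =
    Multiplicative.ofAdd (FreeMonoid.toList w : Multiset X) := by
  change FreeMonoid.lift (fun x => Multiplicative.ofAdd ({x} : Multiset X)) w = _
  induction w using FreeMonoid.recOn with
  | one => rfl
  | of_mul x w h => rw [map_mul, h]; rfl

include hinv in
lemma mk_perm (v w : List X) (h : v.Perm w) :
    (conGen (derivedRel lam rho)).mk' (FreeMonoid.ofList v) =
      (conGen (derivedRel lam rho)).mk' (FreeMonoid.ofList w) := by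
  induction h with
  | nil => rfl
  | cons x _ ih => rw [FreeMonoid.ofList_cons, FreeMonoid.ofList_cons, map_mul, map_mul, ih]
  | swap x y l =>
    simp only [FreeMonoid.ofList_cons, ← mul_assoc]
    rw [map_mul, map_mul _ _ (FreeMonoid.ofList l)]
    congr 1
    apply (Con.eq _).2
    have : derivedRel lam rho (FreeMonoid.of y * FreeMonoid.of x)
      (FreeMonoid.of x * FreeMonoid.of y) := ⟨y, x, rfl, by rw [sigma_id lam rho hinv]⟩
    exact ConGen.Rel.of _ _ this
  | trans _ _ h1 h2 => exact h1.trans h2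

lemma toMs_inj : Function.Injective (toMs lam rho hinv) := by
  intro a b
  induction a using Con.induction_on with
  | H v =>
  induction b using Con.induction_on with
  | H w =>
    intro h
    have h' := (toMs_mk lam rho hinv v).symm.trans (h.trans (toMs_mk lam rho hinv w))
    have h2 : (FreeMonoid.toList v : Multiset X) = FreeMonoid.toList w := h'
    exact mk_perm lam rho hinv _ _ (Multiset.coe_eq_coe.1 h2)

include hinv in
theorem canc_A : ((∀ a b c : DerivedMonoid lam rho, a * c = b * c → a = b) ∧
        (∀ a b c : DerivedMonoid lam rho, c * a = c * b → a = b)) := by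
  constructor
  · intro a b c h
    have := congrArg (toMs lam rho hinv) h
    rw [map_mul, map_mul] at this
    exact toMs_inj lam rho hinv (mul_right_cancel this)
  · intro a b c h
    have := congrArg (toMs lam rho hinv) h
    rw [map_mul, map_mul] at this
    exact toMs_inj lam rho hinv (mul_left_cancel this)

end der
end Sol

theorem stmt19 {X : Type*} [Fintype X] (lam : X → Equiv.Perm X) (rho : X → X → X)
    (hYB1 : ∀ x y z : X, lam x (lam y z) = lam (lam x y) (lam (rho y x) z))
    (hYB2 : ∀ x y z : X,
      lam (rho (lam y z) x) (rho z y) = rho (lam (rho y x) z) (lam x y))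
    (hYB3 : ∀ x y z : X, rho z (rho y x) = rho (rho z y) (rho (lam y z) x))
    (hbij : Function.Bijective (fun p : X × X => (lam p.1 p.2, rho p.2 p.1)))
    (K : Type*) [Field K] :
    -- (1) ⟺ (2): `r` is involutive iff `M(X,r)` is cancellative
    ((∀ p : X × X,
        (fun q : X × X => (lam q.1 q.2, rho q.2 q.1))
          ((fun q : X × X => (lam q.1 q.2, rho q.2 q.1)) p) = p) ↔
      ((∀ a b c : StructureMonoid lam rho, a * c = b * c → a = b) ∧
        (∀ a b c : StructureMonoid lam rho, c * a = c * b → a = b))) ∧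
    -- (1) ⟺ (3): `r` is involutive iff `K[M]` is a domain
    ((∀ p : X × X,
        (fun q : X × X => (lam q.1 q.2, rho q.2 q.1))
          ((fun q : X × X => (lam q.1 q.2, rho q.2 q.1)) p) = p) ↔
      IsDomain (MonoidAlgebra K (StructureMonoid lam rho))) ∧
    -- (1) ⟺ (4): `r` is involutive iff `K[M]` is a prime algebra
    ((∀ p : X × X,
        (fun q : X × X => (lam q.1 q.2, rho q.2 q.1))
          ((fun q : X × X => (lam q.1 q.2, rho q.2 q.1)) p) = p) ↔
      (∀ α β : MonoidAlgebra K (StructureMonoid lam rho),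
        (∀ γ, α * γ * β = 0) → α = 0 ∨ β = 0)) ∧
    -- cancellativity of `M(X,r)` implies cancellativity of the derived monoid `A(X,r)`
    (((∀ a b c : StructureMonoid lam rho, a * c = b * c → a = b) ∧
        (∀ a b c : StructureMonoid lam rho, c * a = c * b → a = b)) →
      ((∀ a b c : DerivedMonoid lam rho, a * c = b * c → a = b) ∧
        (∀ a b c : DerivedMonoid lam rho, c * a = c * b → a = b))) := by
  have hI : (∀ p : X × X, (fun q : X × X => (lam q.1 q.2, rho q.2 q.1))
      ((fun q : X × X => (lam q.1 q.2, rho q.2 q.1)) p) = p) →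
      ∀ x y, lam (lam x y) (rho y x) = x := fun h x y => congrArg Prod.fst (h (x, y))
  have hD : (∀ p : X × X, (fun q : X × X => (lam q.1 q.2, rho q.2 q.1))
      ((fun q : X × X => (lam q.1 q.2, rho q.2 q.1)) p) = p) →
      ∀ s t : MonoidAlgebra K (StructureMonoid lam rho), s * t = 0 → s = 0 ∨ t = 0 := by
    intro h
    have hinv := hI h
    exact Coc.noZeroDiv (Sol.phi lam rho hYB1)
      (Equiv.ofBijective _ ⟨Sol.pi0_inj lam rho hYB1 hinv, Sol.pi0_surj lam rho hYB1 hinv⟩)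
      (Sol.pi0_mul lam rho hYB1 hinv) K
  have h21 : ((∀ a b c : StructureMonoid lam rho, a * c = b * c → a = b) ∧
        (∀ a b c : StructureMonoid lam rho, c * a = c * b → a = b)) →
      (∀ p : X × X, (fun q : X × X => (lam q.1 q.2, rho q.2 q.1))
      ((fun q : X × X => (lam q.1 q.2, rho q.2 q.1)) p) = p) := fun h =>
    Sol.involutive_of lam rho hbij hYB1 hYB2 (fun m n w _ e => h.1 m n w e)
  have hsub : ∀ a b : StructureMonoid lam rho,
      (MonoidAlgebra.single a 1 - MonoidAlgebra.single b 1 : MonoidAlgebra K _) = 0 → a = b := by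
    intro a b h
    have h1 := congrArg MonoidAlgebra.coeff (sub_eq_zero.1 h)
    rw [MonoidAlgebra.coeff_single, MonoidAlgebra.coeff_single] at h1
    exact Finsupp.single_left_injective (one_ne_zero) h1
  have hne : ∀ a : StructureMonoid lam rho,
      (MonoidAlgebra.single a 1 : MonoidAlgebra K (StructureMonoid lam rho)) ≠ 0 := by
    intro a h
    have h1 := congrArg MonoidAlgebra.coeff h
    rw [MonoidAlgebra.coeff_single] at h1
    exact one_ne_zero (Finsupp.single_eq_zero.1 h1)
  have h41 : (∀ α β : MonoidAlgebra K (StructureMonoid lam rho),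
        (∀ γ, α * γ * β = 0) → α = 0 ∨ β = 0) →
      (∀ p : X × X, (fun q : X × X => (lam q.1 q.2, rho q.2 q.1))
      ((fun q : X × X => (lam q.1 q.2, rho q.2 q.1)) p) = p) := by
    intro h
    apply Sol.involutive_of lam rho hbij hYB1 hYB2
    intro m n w hw e
    rcases h (MonoidAlgebra.single m 1 - MonoidAlgebra.single n 1) (MonoidAlgebra.single w 1)
      (by
        intro γ
        have hc : γ * MonoidAlgebra.single w 1 = MonoidAlgebra.single w 1 * γ := by
          induction γ using MonoidAlgebra.induction_linear with
          | zero => simp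
          | add x y hx hy => rw [add_mul, mul_add, hx, hy]
          | single u r =>
            rw [MonoidAlgebra.single_mul_single, MonoidAlgebra.single_mul_single, hw, mul_comm r]
        rw [mul_assoc, hc, ← mul_assoc, sub_mul, MonoidAlgebra.single_mul_single,
          MonoidAlgebra.single_mul_single, e, sub_self, zero_mul]) with h1 | h1
    · exact hsub m n h1
    · exact absurd h1 (hne w)
  refine ⟨⟨fun h => ?_, h21⟩, ⟨fun h => ?_, fun h => h41 ?_⟩, ⟨fun h => ?_, h41⟩, fun h => ?_⟩
  · constructor
    · intro a b c e
      rcases hD h (MonoidAlgebra.single a 1 - MonoidAlgebra.single b 1) (MonoidAlgebra.single c 1)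
        (by rw [sub_mul, MonoidAlgebra.single_mul_single, MonoidAlgebra.single_mul_single, e,
              sub_self]) with h1 | h1
      · exact hsub a b h1
      · exact absurd h1 (hne c)
    · intro a b c e
      rcases hD h (MonoidAlgebra.single c 1) (MonoidAlgebra.single a 1 - MonoidAlgebra.single b 1)
        (by rw [mul_sub, MonoidAlgebra.single_mul_single, MonoidAlgebra.single_mul_single, e,
              sub_self]) with h1 | h1
      · exact absurd h1 (hne c)
      · exact hsub a b h1
  · have : NoZeroDivisors (MonoidAlgebra K (StructureMonoid lam rho)) :=
      ⟨fun {s t} e => hD h s t e⟩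
    have : Nontrivial (MonoidAlgebra K (StructureMonoid lam rho)) := ⟨_, _, hne 1⟩
    exact NoZeroDivisors.to_isDomain _
  · intro α β hab
    have := hab 1
    rw [mul_one] at this
    exact mul_eq_zero.1 this
  · intro α β hab
    have := hab 1
    rw [mul_one] at this
    exact hD h α β this
  · exact Sol.canc_A lam rho (hI (h21 h))
end
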